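/- Let q be a prime power of characteristic p and f(x) ∈ F_q[x] monic of degree d = k+m ≤ q−1 with k ≥ 1, m ≥ 0. For k+1 ≤ r ≤ d, let M(f, r) be the number of pairs (D_r, g) where D_r ⊆ F_q has |D_r| = r, g ∈ F_q[x] has degree at most k−1, and f(a)+g(a) = 0 for every a ∈ D_r. Then |M(f, r) − C(q, r) q^{k−r}| ≤ C(q/p + m√q + r, r) · C(m−1, d−r) · q^{(d−r)/2}. -/

import Mathlib

open Polynomial

/-- Generalized (real-argument) binomial coefficient `C(a,b) = Γ(a+1)/(Γ(b+1)Γ(a-b+1))`. -/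
noncomputable def gchoose (a b : ℝ) : ℝ :=
  Real.Gamma (a + 1) / (Real.Gamma (b + 1) * Real.Gamma (a - b + 1))

/-- rising factorial coefficients -/
noncomputable def risc (A : ℝ) : ℕ → ℝ
  | 0 => 1
  | (r + 1) => risc A r * (A + r) / (r + 1)

lemma risc_pos {A : ℝ} (hA : 1 ≤ A) (r : ℕ) : 0 < risc A r := by
  induction r with
  | zero => simp [risc]
  | succ r ih => rw [risc]; positivity

lemma risc_mono {A : ℝ} (hA : 1 ≤ A) : Monotone (risc A) := by
  apply monotone_nat_of_le_succ
  intro r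
  rw [risc, le_div_iff₀ (by positivity)]
  have := risc_pos hA r
  nlinarith

lemma risc_sum (A : ℝ) (r : ℕ) : r * risc A r = A * ∑ i ∈ Finset.range r, risc A i := by
  induction r with
  | zero => simp
  | succ r ih =>
    rw [Finset.sum_range_succ, mul_add, ← ih, risc]
    push_cast
    field_simp
    ring

lemma gchoose_eq {a : ℝ} (ha : 0 ≤ a) (r : ℕ) : gchoose (a + r) r = risc (a + 1) r := by
  unfold gchoose
  induction r with
  | zero =>
    have : Real.Gamma (a + 1) ≠ 0 := (Real.Gamma_pos_of_pos (by linarith)).ne'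
    simp [risc, this]
  | succ r ih =>
    rw [risc, ← ih]
    have h0 : Real.Gamma (a + 1) ≠ 0 := (Real.Gamma_pos_of_pos (by linarith)).ne'
    have h1 : Real.Gamma ((r : ℝ) + 1) ≠ 0 := (Real.Gamma_pos_of_pos (by positivity)).ne'
    have e1 : a + ((r + 1 : ℕ) : ℝ) + 1 = (a + r + 1) + 1 := by push_cast; ring
    have e2 : ((r + 1 : ℕ) : ℝ) + 1 = ((r : ℝ) + 1) + 1 := by push_cast; ring
    have e3 : a + ((r + 1 : ℕ) : ℝ) - ((r + 1 : ℕ) : ℝ) + 1 = a + 1 := by push_cast; ring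
    have e4 : a + (r : ℝ) - r + 1 = a + 1 := by ring
    rw [e1, e2, e3, e4, Real.Gamma_add_one (s := a + r + 1) (by positivity),
      Real.Gamma_add_one (s := (r : ℝ) + 1) (by positivity)]
    have : (r : ℝ) + 1 ≠ 0 := by positivity
    field_simp
    ring

/-- block averaging -/
lemma block_sum (c : ℕ → ℝ) (hc : Monotone c) (hc0 : ∀ i, 0 ≤ c i) (p : ℕ) (hp : 0 < p) (r : ℕ) :
    (p : ℝ) * ∑ i ∈ Finset.range r, (if p ∣ (r - i) then c i else 0) ≤ ∑ i ∈ Finset.range r, c i := by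
  induction r using Nat.strong_induction_on with
  | _ r ih =>
    by_cases hrp : r < p
    · rw [Finset.sum_eq_zero, mul_zero]
      · exact Finset.sum_nonneg fun i _ => hc0 i
      · intro i hi
        rw [Finset.mem_range] at hi
        rw [if_neg]
        intro h
        have := Nat.le_of_dvd (by omega) h
        omega
    · obtain ⟨s, rfl⟩ : ∃ s, r = s + p := ⟨r - p, by omega⟩
      rw [Finset.sum_range_add, Finset.sum_range_add, mul_add]
      have h1 := ih s (by omega)
      have e1 : ∑ i ∈ Finset.range s, (if p ∣ (s + p - i) then c i else 0)
          = ∑ i ∈ Finset.range s, (if p ∣ (s - i) then c i else 0) := by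
        apply Finset.sum_congr rfl
        intro i hi
        rw [Finset.mem_range] at hi
        have : s + p - i = (s - i) + p := by omega
        rw [this]
        simp
      have e2 : ∑ i ∈ Finset.range p, (if p ∣ (s + p - (s + i)) then c (s + i) else 0) = c s := by
        rw [Finset.sum_eq_single 0]
        · simp
        · intro i hi h0
          rw [Finset.mem_range] at hi
          rw [if_neg]
          intro h
          have := Nat.le_of_dvd (by omega) h
          omega
        · intro h; simp at h; omega
      have e3 : (p : ℝ) * c s ≤ ∑ i ∈ Finset.range p, c (s + i) := by
        have := Finset.card_nsmul_le_sum (Finset.range p) (fun i => c (s + i)) (c s)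
          (fun i _ => hc (by omega))
        simpa using this
      rw [e1, e2]
      linarith

lemma newton {σ : Type*} [Fintype σ] [DecidableEq σ] (x : σ → ℂ) (k : ℕ) :
    (k : ℂ) * ∑ D ∈ Finset.powersetCard k (Finset.univ : Finset σ), ∏ i ∈ D, x i =
      (-1) ^ (k + 1) * ∑ a ∈ Finset.range k,
        (-1) ^ a * (∑ D ∈ Finset.powersetCard a (Finset.univ : Finset σ), ∏ i ∈ D, x i) *
          ∑ i, x i ^ (k - a) := by
  have h := congrArg (MvPolynomial.aeval x) (MvPolynomial.mul_esymm_eq_sum σ ℂ k)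
  simp only [map_mul, map_sum, MvPolynomial.esymm, MvPolynomial.psum, map_pow, map_prod,
    MvPolynomial.aeval_X, map_natCast, map_neg, map_one] at h
  rw [h]
  congr 1
  rw [Finset.sum_filter, Finset.Nat.sum_antidiagonal_eq_sum_range_succ_mk,
    Finset.sum_range_succ]
  simp only [lt_irrefl, if_false, add_zero]
  apply Finset.sum_congr rfl
  intro a ha
  rw [if_pos (by simpa using ha)]

lemma esymm_bound {σ : Type*} [Fintype σ] [DecidableEq σ] (x : σ → ℂ) (w Q A : ℝ) (p : ℕ)
    (hp : 0 < p) (hQ : 0 ≤ Q) (hA : w + Q / p ≤ A) (hA1 : 1 ≤ A)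
    (hx : ∀ j, 1 ≤ j → ‖∑ i, x i ^ j‖ ≤ w + if p ∣ j then Q else 0) (r : ℕ) :
    ‖∑ D ∈ Finset.powersetCard r (Finset.univ : Finset σ), ∏ i ∈ D, x i‖ ≤ risc A r := by
  induction r using Nat.strong_induction_on with
  | _ r ih =>
    rcases Nat.eq_zero_or_pos r with rfl | hr
    · simp [risc]
    · have hr' : (0 : ℝ) < r := by exact_mod_cast hr
      have h := congrArg norm (newton x r)
      rw [norm_mul, norm_mul] at h
      simp only [norm_pow, norm_neg, norm_one, one_pow, one_mul, Complex.norm_natCast] at h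
      refine le_of_mul_le_mul_left ?_ hr'
      rw [h, risc_sum]
      calc _ ≤ ∑ a ∈ Finset.range r, risc A a * (w + if p ∣ (r - a) then Q else 0) := by
            refine (norm_sum_le _ _).trans (Finset.sum_le_sum fun a ha => ?_)
            rw [Finset.mem_range] at ha
            rw [norm_mul, norm_mul]
            simp only [norm_pow, norm_neg, norm_one, one_pow, one_mul]
            exact mul_le_mul (ih a ha) (hx _ (by omega)) (norm_nonneg _) (risc_pos hA1 a).le
        _ = w * ∑ a ∈ Finset.range r, risc A a + (Q / p) * (p * ∑ a ∈ Finset.range r,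
              if p ∣ (r - a) then risc A a else 0) := by
            have : (p : ℝ) ≠ 0 := by positivity
            rw [← mul_assoc, div_mul_cancel₀ _ this, Finset.mul_sum, Finset.mul_sum,
              ← Finset.sum_add_distrib]
            apply Finset.sum_congr rfl
            intro a _
            split_ifs <;> ring
        _ ≤ w * ∑ a ∈ Finset.range r, risc A a + (Q / p) * ∑ a ∈ Finset.range r, risc A a := by
            gcongr
            exact block_sum _ (risc_mono hA1) (fun i => (risc_pos hA1 i).le) p hp r
        _ = (w + Q / p) * ∑ a ∈ Finset.range r, risc A a := by ring
        _ ≤ _ := by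
            gcongr
            exact Finset.sum_nonneg fun i _ => (risc_pos hA1 i).le

lemma psum_bound {n : ℕ} (ω : Fin n → ℂ) (q C : ℝ) (hq : 0 < q) (μ0 : ℕ)
    (h : ∀ μ, μ0 ≤ μ → ‖∑ i, ω i ^ (2 * μ)‖ ≤ C * q ^ μ) (i : Fin n) : ‖ω i‖ ≤ Real.sqrt q := by
  classical
  set b : Fin n → ℂ := fun i => ω i ^ 2 with hb
  have hC : 0 ≤ C := by
    have := (norm_nonneg _).trans (h μ0 le_rfl)
    exact nonneg_of_mul_nonneg_left this (by positivity)
  let P : ℂ[X] := ∏ c ∈ (Finset.univ.image b).erase (b i), (X - Polynomial.C c)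
  have hP0 : ∀ j, b j ≠ b i → P.eval (b j) = 0 := by
    intro j hj
    simp only [P, eval_prod]
    refine Finset.prod_eq_zero (i := b j) (by simp [hj]) (by simp)
  have hP1 : P.eval (b i) ≠ 0 := by
    simp only [P, eval_prod]
    rw [Finset.prod_ne_zero_iff]
    intro c hc
    have := Finset.ne_of_mem_erase hc
    rw [eval_sub, eval_X, eval_C]; exact sub_ne_zero.mpr this.symm
  let N : ℕ := (Finset.univ.filter fun j => b j = b i).card
  have hN : 1 ≤ N := Finset.card_pos.mpr ⟨i, by simp⟩
  have key : ∀ μ, (N : ℂ) * (P.eval (b i) * b i ^ μ) =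
      ∑ k ∈ Finset.range (P.natDegree + 1), P.coeff k * ∑ j, b j ^ (μ + k) := by
    intro μ
    have : ∀ j, P.eval (b j) * b j ^ μ = if b j = b i then P.eval (b i) * b i ^ μ else 0 := by
      intro j
      split_ifs with hj
      · rw [hj]
      · rw [hP0 j hj, zero_mul]
    calc _ = ∑ j, P.eval (b j) * b j ^ μ := by
          rw [Finset.sum_congr rfl fun j _ => this j]
          rw [← Finset.sum_filter, Finset.sum_const, nsmul_eq_mul]
      _ = _ := by
          simp_rw [eval_eq_sum_range, Finset.sum_mul, Finset.mul_sum]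
          rw [Finset.sum_comm]
          refine Finset.sum_congr rfl fun k _ => Finset.sum_congr rfl fun j _ => by ring
  let K : ℝ := ∑ k ∈ Finset.range (P.natDegree + 1), ‖P.coeff k‖ * (C * q ^ k)
  have bound : ∀ μ, μ0 ≤ μ → ‖P.eval (b i)‖ * ‖b i‖ ^ μ ≤ K * q ^ μ := by
    intro μ hμ
    have h1 := congrArg norm (key μ)
    rw [norm_mul, norm_mul, Complex.norm_natCast, norm_pow] at h1
    have h2 : ‖P.eval (b i)‖ * ‖b i‖ ^ μ ≤ N * (‖P.eval (b i)‖ * ‖b i‖ ^ μ) := by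
      have : (1 : ℝ) ≤ N := by exact_mod_cast hN
      exact le_mul_of_one_le_left (by positivity) this
    refine h2.trans (h1.le.trans ((norm_sum_le _ _).trans ?_))
    rw [Finset.sum_mul]
    refine Finset.sum_le_sum fun k _ => ?_
    rw [norm_mul]
    have := h (μ + k) (by omega)
    have e : ∑ j, b j ^ (μ + k) = ∑ j, ω j ^ (2 * (μ + k)) := by
      simp only [hb, ← pow_mul]
    rw [e, mul_assoc, mul_assoc]
    refine mul_le_mul_of_nonneg_left (this.trans (le_of_eq ?_)) (norm_nonneg _)
    ring
  have hbi : ‖b i‖ ≤ q := by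
    by_contra hcon
    push Not at hcon
    have h1 : 1 < ‖b i‖ / q := by rwa [one_lt_div hq]
    have hp : 0 < ‖P.eval (b i)‖ := norm_pos_iff.mpr hP1
    obtain ⟨μ, hμ⟩ := pow_unbounded_of_one_lt (K / ‖P.eval (b i)‖) h1
    have h2 := bound (μ + μ0) (by omega)
    have h3 : (‖b i‖ / q) ^ μ ≤ (‖b i‖ / q) ^ (μ + μ0) := pow_le_pow_right₀ h1.le (by omega)
    have h4 := hμ.trans_le h3
    rw [div_pow, div_lt_div_iff₀ hp (by positivity)] at h4
    linarith
  apply Real.le_sqrt_of_sq_le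
  simpa [hb] using hbi

section monic
variable {F : Type*} [Field F] [Fintype F]

open Classical in
/-- monic polynomials of degree `n` -/
noncomputable def Mon (F : Type*) [Field F] [Fintype F] (n : ℕ) : Finset F[X] :=
  Finset.univ.image (fun c : Fin n → F => X ^ n + ((degreeLTEquiv F n).symm c : F[X]))

lemma mem_Mon {n : ℕ} {h : F[X]} : h ∈ Mon F n ↔ h.Monic ∧ h.natDegree = n := by
  classical
  unfold Mon
  rw [Finset.mem_image]
  constructor
  · rintro ⟨c, -, rfl⟩
    have hd := mem_degreeLT.mp ((degreeLTEquiv F n).symm c).2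
    have hd' : ((degreeLTEquiv F n).symm c : F[X]).degree < (X ^ n : F[X]).degree := by
      simpa using hd
    refine ⟨(monic_X_pow n).add_of_left hd', ?_⟩
    rw [natDegree_eq_of_degree_eq (degree_add_eq_left_of_degree_lt hd'), natDegree_X_pow]
  · rintro ⟨hm, hn⟩
    have hd : h - X ^ n ∈ degreeLT F n := by
      rw [mem_degreeLT]
      have : h.degree = n := by rw [degree_eq_natDegree hm.ne_zero, hn]
      rw [← this]
      refine degree_sub_lt ?_ hm.ne_zero ?_
      · rw [this, degree_X_pow]
      · rw [hm.leadingCoeff, (monic_X_pow n).leadingCoeff]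
    refine ⟨degreeLTEquiv F n ⟨_, hd⟩, Finset.mem_univ _, ?_⟩
    simp

lemma card_Mon (n : ℕ) : (Mon F n).card = Fintype.card F ^ n := by
  classical
  unfold Mon
  rw [Finset.card_image_of_injective]
  · simp
  · intro a b hab
    simpa using hab

lemma Mon_zero : Mon F 0 = {1} := by
  ext h
  rw [mem_Mon, Finset.mem_singleton]
  constructor
  · rintro ⟨h1, h2⟩; exact eq_one_of_monic_natDegree_zero h1 h2
  · rintro rfl; simp

open Classical in
/-- monic irreducibles of degree at most `n` -/
noncomputable def IrrLE (F : Type*) [Field F] [Fintype F] (n : ℕ) : Finset F[X] :=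
  ((Finset.range (n + 1)).biUnion (Mon F)).filter Irreducible

lemma mem_IrrLE {n : ℕ} {P : F[X]} :
    P ∈ IrrLE F n ↔ P.Monic ∧ P.natDegree ≤ n ∧ Irreducible P := by
  classical
  simp only [IrrLE, Finset.mem_filter, Finset.mem_biUnion, Finset.mem_range, mem_Mon]
  constructor
  · rintro ⟨⟨a, h1, h2, h3⟩, h4⟩; exact ⟨h2, by omega, h4⟩
  · rintro ⟨h1, h2, h3⟩; exact ⟨⟨P.natDegree, by omega, h1, rfl⟩, h3⟩

open Classical in
/-- monic irreducibles of degree dividing `n` -/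
noncomputable def IrrDvd (F : Type*) [Field F] [Fintype F] (n : ℕ) : Finset F[X] :=
  (IrrLE F n).filter fun P => P.natDegree ∣ n

lemma mem_IrrDvd {n : ℕ} (hn : 0 < n) {P : F[X]} :
    P ∈ IrrDvd F n ↔ P.Monic ∧ Irreducible P ∧ P.natDegree ∣ n := by
  classical
  simp only [IrrDvd, Finset.mem_filter, mem_IrrLE]
  constructor
  · rintro ⟨⟨h1, h2, h3⟩, h4⟩; exact ⟨h1, h3, h4⟩
  · rintro ⟨h1, h2, h3⟩; exact ⟨⟨h1, Nat.le_of_dvd hn h3, h2⟩, h3⟩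

/-- the degree as a sum over prime powers dividing `h` -/
lemma degree_sum [DecidableEq F] {n : ℕ} {h : F[X]} (hh : h ∈ Mon F n) :
    n = ∑ P ∈ IrrLE F n, ∑ j ∈ Finset.Icc 1 n, open Classical in if P ^ j ∣ h then P.natDegree else 0 := by
  classical
  rw [mem_Mon] at hh
  obtain ⟨hm, hn⟩ := hh
  have h0 := hm.ne_zero
  let s := UniqueFactorizationMonoid.normalizedFactors h
  have hs : s.prod = h := by
    have := UniqueFactorizationMonoid.prod_normalizedFactors_eq h0
    rw [this, hm.normalize_eq_self]
  have hs1 : ∀ P ∈ s, P.Monic ∧ Irreducible P ∧ P ∣ h := by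
    intro P hP
    have h1 := UniqueFactorizationMonoid.irreducible_of_normalized_factor P hP
    have h2 := UniqueFactorizationMonoid.normalize_normalized_factor P hP
    refine ⟨?_, h1, UniqueFactorizationMonoid.dvd_of_mem_normalizedFactors hP⟩
    rw [← h2]
    exact monic_normalize h1.ne_zero
  have hdeg : n = (s.map natDegree).sum := by
    rw [← hn]
    conv_lhs => rw [← hs]
    exact natDegree_multiset_prod_of_monic s (fun P hP => (hs1 P hP).1)
  have hsub : s.toFinset ⊆ IrrLE F n := by
    intro P hP
    rw [Multiset.mem_toFinset] at hP
    obtain ⟨h1, h2, h3⟩ := hs1 P hP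
    rw [mem_IrrLE]
    exact ⟨h1, hn ▸ natDegree_le_of_dvd h3 h0, h2⟩
  conv_lhs => rw [hdeg, Finset.sum_multiset_map_count]
  rw [Finset.sum_subset hsub]
  · apply Finset.sum_congr rfl
    intro P hP
    rw [mem_IrrLE] at hP
    obtain ⟨h1, h2, h3⟩ := hP
    have hc : ∀ j, P ^ j ∣ h ↔ j ≤ s.count P := by
      intro j
      have := UniqueFactorizationMonoid.emultiplicity_eq_count_normalizedFactors h3 h0
      rw [h1.normalize_eq_self] at this
      rw [pow_dvd_iff_le_emultiplicity, this, Nat.cast_le]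
    have hcn : s.count P ≤ n := by
      have h4 : P ^ (s.count P) ∣ h := (hc _).mpr le_rfl
      have h5 := natDegree_le_of_dvd h4 h0
      rw [natDegree_pow, hn] at h5
      have := h3.natDegree_pos
      nlinarith
    simp_rw [hc]
    rw [← Finset.sum_filter, Finset.sum_const]
    congr 1
    have : Finset.filter (fun j => j ≤ s.count P) (Finset.Icc 1 n) = Finset.Icc 1 (s.count P) := by
      ext j; simp only [Finset.mem_filter, Finset.mem_Icc]; omega
    rw [this]; simp
  · intro P _ hP
    rw [Multiset.mem_toFinset] at hP
    rw [Multiset.count_eq_zero_of_notMem hP, zero_smul]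

/-- power sums attached to a multiplicative function on monic polynomials -/
noncomputable def SS (ψ : F[X] → ℂ) (n : ℕ) : ℂ :=
  ∑ P ∈ IrrDvd F n, (P.natDegree : ℂ) * ψ P ^ (n / P.natDegree)

noncomputable def AA (ψ : F[X] → ℂ) (n : ℕ) : ℂ := ∑ h ∈ Mon F n, ψ h

lemma psi_pow (ψ : F[X] → ℂ) (h1 : ψ 1 = 1)
    (hmul : ∀ f g : F[X], f.Monic → g.Monic → ψ (f * g) = ψ f * ψ g) {P : F[X]} (hP : P.Monic)
    (j : ℕ) : ψ (P ^ j) = ψ P ^ j := by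
  induction j with
  | zero => simp [h1]
  | succ j ih => rw [pow_succ, hmul _ _ (hP.pow j) hP, ih, pow_succ]

lemma sum_dvd (ψ : F[X] → ℂ) (h1 : ψ 1 = 1)
    (hmul : ∀ f g : F[X], f.Monic → g.Monic → ψ (f * g) = ψ f * ψ g) {P : F[X]} (hP : P.Monic)
    (j n : ℕ) :
    ∑ h ∈ Mon F n, (open Classical in if P ^ j ∣ h then ψ h else 0) =
      if j * P.natDegree ≤ n then ψ P ^ j * AA ψ (n - j * P.natDegree) else 0 := by
  classical
  rw [← Finset.sum_filter]
  have hPj := hP.pow j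
  have hdj : (P ^ j).natDegree = j * P.natDegree := natDegree_pow _ _
  split_ifs with hle
  · unfold AA
    rw [Finset.mul_sum]
    symm
    apply Finset.sum_bij (fun h _ => P ^ j * h)
    · intro h hh
      rw [mem_Mon] at hh
      rw [Finset.mem_filter, mem_Mon]
      refine ⟨⟨hPj.mul hh.1, ?_⟩, dvd_mul_right _ _⟩
      rw [hPj.natDegree_mul hh.1, hdj, hh.2]; omega
    · intro a _ b _ hab
      exact mul_left_cancel₀ hPj.ne_zero hab
    · intro b hb
      rw [Finset.mem_filter, mem_Mon] at hb
      obtain ⟨⟨hb1, hb2⟩, c, rfl⟩ := hb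
      have hc : c.Monic := hPj.of_mul_monic_left hb1
      refine ⟨c, ?_, rfl⟩
      rw [mem_Mon]
      refine ⟨hc, ?_⟩
      rw [hPj.natDegree_mul hc, hdj] at hb2; omega
    · intro a ha
      rw [mem_Mon] at ha
      rw [hmul _ _ hPj ha.1, psi_pow ψ h1 hmul hP]
  · rw [Finset.filter_eq_empty_iff.mpr, Finset.sum_empty]
    intro h hh hd
    rw [mem_Mon] at hh
    have := natDegree_le_of_dvd hd hh.1.ne_zero
    omega

lemma conv_identity (ψ : F[X] → ℂ) (h1 : ψ 1 = 1)
    (hmul : ∀ f g : F[X], f.Monic → g.Monic → ψ (f * g) = ψ f * ψ g) (n : ℕ) :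
    (n : ℂ) * AA ψ n = ∑ ν ∈ Finset.Icc 1 n, SS ψ ν * AA ψ (n - ν) := by
  classical
  have L : (n : ℂ) * AA ψ n = ∑ P ∈ IrrLE F n, ∑ j ∈ Finset.Icc 1 n,
      (P.natDegree : ℂ) * if j * P.natDegree ≤ n then ψ P ^ j * AA ψ (n - j * P.natDegree) else 0 := by
    calc (n : ℂ) * AA ψ n = ∑ h ∈ Mon F n, (n : ℂ) * ψ h := by rw [AA, Finset.mul_sum]
      _ = ∑ h ∈ Mon F n, ∑ P ∈ IrrLE F n, ∑ j ∈ Finset.Icc 1 n,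
            (P.natDegree : ℂ) * if P ^ j ∣ h then ψ h else 0 := by
          refine Finset.sum_congr rfl fun h hh => ?_
          have := congrArg (Nat.cast : ℕ → ℂ) (degree_sum hh)
          rw [this]
          push_cast
          rw [Finset.sum_mul]
          refine Finset.sum_congr rfl fun P _ => ?_
          rw [Finset.sum_mul]
          refine Finset.sum_congr rfl fun j _ => ?_
          split_ifs <;> simp
      _ = _ := by
          rw [Finset.sum_comm]
          refine Finset.sum_congr rfl fun P hP => ?_
          rw [Finset.sum_comm]
          refine Finset.sum_congr rfl fun j _ => ?_
          rw [← Finset.mul_sum, ← sum_dvd ψ h1 hmul (mem_IrrLE.mp hP).1]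
  have R : ∑ ν ∈ Finset.Icc 1 n, SS ψ ν * AA ψ (n - ν) = ∑ P ∈ IrrLE F n, ∑ ν ∈ Finset.Icc 1 n,
      if P.natDegree ∣ ν then (P.natDegree : ℂ) * (ψ P ^ (ν / P.natDegree) * AA ψ (n - ν)) else 0 := by
    rw [Finset.sum_comm]
    refine Finset.sum_congr rfl fun ν hν => ?_
    rw [Finset.mem_Icc] at hν
    rw [← Finset.sum_filter, SS, Finset.sum_mul]
    have : IrrDvd F ν = (IrrLE F n).filter fun P => P.natDegree ∣ ν := by
      ext P
      rw [mem_IrrDvd (by omega), Finset.mem_filter, mem_IrrLE]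
      constructor
      · rintro ⟨a, b, c⟩; exact ⟨⟨a, (Nat.le_of_dvd (by omega) c).trans hν.2, b⟩, c⟩
      · rintro ⟨⟨a, b, c⟩, d⟩; exact ⟨a, c, d⟩
    rw [this]
    refine Finset.sum_congr rfl fun P _ => by ring
  rw [L, R]
  refine Finset.sum_congr rfl fun P hP => ?_
  have hd : 0 < P.natDegree := (mem_IrrLE.mp hP).2.2.natDegree_pos
  simp_rw [mul_ite, mul_zero]
  rw [← Finset.sum_filter, ← Finset.sum_filter]
  apply Finset.sum_bij (fun j _ => j * P.natDegree)
  · intro j hj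
    simp only [Finset.mem_filter, Finset.mem_Icc] at hj ⊢
    refine ⟨⟨?_, hj.2⟩, dvd_mul_left _ _⟩
    exact Nat.mul_pos hj.1.1 hd
  · intro a _ b _ hab
    exact Nat.eq_of_mul_eq_mul_right hd hab
  · intro ν hν
    simp only [Finset.mem_filter, Finset.mem_Icc] at hν
    obtain ⟨⟨h2, h3⟩, j, rfl⟩ := hν
    refine ⟨j, ?_, mul_comm _ _⟩
    simp only [Finset.mem_filter, Finset.mem_Icc]
    have : 0 < j := Nat.pos_of_ne_zero (by rintro rfl; simp at h2)
    refine ⟨⟨this, ?_⟩, by rwa [mul_comm]⟩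
    exact (Nat.le_mul_of_pos_left j hd).trans h3
  · intro j hj
    rw [Nat.mul_div_cancel _ hd]

/-- total mass -/
lemma SS_one (n : ℕ) (hn : 1 ≤ n) : SS (F := F) (fun _ => 1) n = (Fintype.card F : ℂ) ^ n := by
  have hA : ∀ n, AA (F := F) (fun _ => 1) n = (Fintype.card F : ℂ) ^ n := by
    intro n; simp [AA, card_Mon]
  induction n using Nat.strong_induction_on with
  | _ n ih =>
    have h := conv_identity (F := F) (fun _ => 1) rfl (by simp) n
    obtain ⟨k, rfl⟩ : ∃ k, n = k + 1 := ⟨n - 1, by omega⟩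
    rw [Finset.sum_Icc_succ_top (by omega)] at h
    have e : ∑ ν ∈ Finset.Icc 1 k, SS (F := F) (fun _ => 1) ν * AA (F := F) (fun _ => 1) (k + 1 - ν)
        = k * (Fintype.card F : ℂ) ^ (k + 1) := by
      rw [Finset.sum_congr rfl (g := fun _ => (Fintype.card F : ℂ) ^ (k + 1))]
      · simp
      · intro ν hν
        rw [Finset.mem_Icc] at hν
        rw [ih ν (by omega) hν.1, hA, ← pow_add]
        congr 1; omega
    rw [e, hA, hA] at h
    simp only [Nat.sub_self, pow_zero, mul_one] at h
    push_cast at h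
    linear_combination -h

end monic

section digits

/-- partial geometric sums -/
def vv (q μ j : ℕ) : ℕ := ∑ i ∈ Finset.range j, q ^ (μ - 1 - i)

lemma vv_zero (q μ : ℕ) : vv q μ 0 = 0 := by simp [vv]

lemma vv_succ (q μ j : ℕ) : vv q μ (j + 1) = vv q μ j + q ^ (μ - 1 - j) := by
  simp [vv, Finset.sum_range_succ]

lemma vv_succ_succ (q μ j : ℕ) : vv q (μ + 1) (j + 1) = q ^ μ + vv q μ j := by
  simp only [vv]
  rw [Finset.sum_range_succ', add_comm]
  congr 1
  apply Finset.sum_congr rfl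
  intro i _
  congr 1
  omega

lemma vv_lt {q : ℕ} (hq : 2 ≤ q) : ∀ μ j : ℕ, j ≤ μ → vv q μ j < q ^ μ := by
  intro μ
  induction μ with
  | zero => intro j hj; obtain rfl : j = 0 := by omega
            simp [vv]
  | succ μ ih =>
    intro j hj
    rcases j with _ | j
    · rw [vv_zero]; positivity
    · rw [vv_succ_succ, pow_succ]
      have := ih j (by omega)
      nlinarith [pow_pos (show 0 < q by omega) μ]

lemma vv_dvd (q μ : ℕ) : ∀ j i : ℕ, j ≤ i → i ≤ μ → q ^ (μ - i) ∣ vv q μ j := by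
  intro j i hj hi
  apply Finset.dvd_sum
  intro l hl
  rw [Finset.mem_range] at hl
  apply pow_dvd_pow
  omega

lemma digits_inj {q : ℕ} (hq : 2 ≤ q) (μ : ℕ) (m : ℕ) (hm : m ≤ μ) : ∀ (k k' e0 e0' : ℕ) (e e' : ℕ → ℕ),
    k < q ^ (μ - m) → k' < q ^ (μ - m) → (∀ j < m, e j < q) → (∀ j < m, e' j < q) →
    k + q ^ μ * e0 + ∑ j ∈ Finset.range m, e j * vv q μ (j + 1) =
      k' + q ^ μ * e0' + ∑ j ∈ Finset.range m, e' j * vv q μ (j + 1) →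
    k = k' ∧ e0 = e0' ∧ ∀ j < m, e j = e' j := by
  induction m with
  | zero =>
    intro k k' e0 e0' e e' hk hk' _ _ h
    simp only [Finset.range_zero, Finset.sum_empty, add_zero, Nat.sub_zero] at h hk hk'
    have h1 := congrArg (· % q ^ μ) h
    simp only [Nat.add_mul_mod_self_left, Nat.mod_eq_of_lt hk, Nat.mod_eq_of_lt hk'] at h1
    subst h1
    have : q ^ μ * e0 = q ^ μ * e0' := by omega
    exact ⟨rfl, Nat.eq_of_mul_eq_mul_left (by positivity) this, by simp⟩
  | succ m ih =>
    intro k k' e0 e0' e e' hk hk' he he' h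
    set W := q ^ (μ - (m + 1)) with hW
    have hWq : q ^ (μ - m) = q * W := by
      rw [hW, ← pow_succ']; congr 1; omega
    have hW0 : 0 < W := by positivity
    have key : ∀ (k e0 : ℕ) (e : ℕ → ℕ), k < W → e m < q →
        (k + q ^ μ * e0 + ∑ j ∈ Finset.range (m + 1), e j * vv q μ (j + 1)) % (q * W) = k + e m * W := by
      intro k e0 e hk he
      obtain ⟨c, hc⟩ : q * W ∣ q ^ μ * e0 + ∑ j ∈ Finset.range m, e j * vv q μ (j + 1) + e m * vv q μ m := by
        rw [← hWq]
        refine dvd_add (dvd_add ?_ ?_) ?_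
        · exact Dvd.dvd.mul_right (pow_dvd_pow _ (by omega)) _
        · apply Finset.dvd_sum
          intro j hj
          rw [Finset.mem_range] at hj
          exact Dvd.dvd.mul_left (vv_dvd q μ _ _ (by omega) (by omega)) _
        · exact Dvd.dvd.mul_left (vv_dvd q μ _ _ (by omega) (by omega)) _
      have e1 : k + q ^ μ * e0 + ∑ j ∈ Finset.range (m + 1), e j * vv q μ (j + 1)
          = (k + e m * W) + q * W * c := by
        rw [← hc, Finset.sum_range_succ, vv_succ, show μ - 1 - m = μ - (m + 1) by omega, ← hW]
        ring
      rw [e1, Nat.add_mul_mod_self_left, Nat.mod_eq_of_lt]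
      nlinarith
    have h1 := congrArg (· % (q * W)) h
    simp only [key k e0 e hk (he m (by omega)), key k' e0' e' hk' (he' m (by omega))] at h1
    have hkk : k = k' := by
      have := congrArg (· % W) h1
      simpa [Nat.mod_eq_of_lt hk, Nat.mod_eq_of_lt hk'] using this
    subst hkk
    have hem : e m = e' m := Nat.eq_of_mul_eq_mul_right hW0 (by omega)
    rw [Finset.sum_range_succ, Finset.sum_range_succ, hem] at h
    obtain ⟨-, h2, h3⟩ := ih (by omega) 0 0 e0 e0' e e' (by positivity) (by positivity)
      (fun j hj => he j (by omega)) (fun j hj => he' j (by omega)) (by omega)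
    refine ⟨rfl, h2, fun j hj => ?_⟩
    rcases Nat.lt_succ_iff_lt_or_eq.mp hj with h4 | rfl
    · exact h3 j h4
    · exact hem

end digits

section stepanov
variable {F : Type*} [Field F]

/-- product of `1 - z^{q^i} t` -/
noncomputable def YY (F : Type*) [Field F] (q μ : ℕ) : PowerSeries F[X] :=
  ∏ i ∈ Finset.range μ, (1 - PowerSeries.C (X ^ q ^ i) * PowerSeries.X)

noncomputable def ZZ (F : Type*) [Field F] (q μ : ℕ) : PowerSeries F[X] :=
  ∏ i ∈ Finset.range μ, PowerSeries.mk (fun k => (X ^ q ^ i : F[X]) ^ k)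

lemma YY_mul_ZZ (q μ : ℕ) : YY F q μ * ZZ F q μ = 1 := by
  unfold YY ZZ
  rw [← Finset.prod_mul_distrib]
  apply Finset.prod_eq_one
  intro i _
  ext1 n
  rw [sub_mul, one_mul, mul_assoc, map_sub, PowerSeries.coeff_C_mul]
  rcases n with _ | n
  · simp
  · rw [PowerSeries.coeff_succ_X_mul, PowerSeries.coeff_mk, PowerSeries.coeff_mk,
      PowerSeries.coeff_one]
    simp [pow_succ']

lemma YY_coeff_succ (q μ j : ℕ) : PowerSeries.coeff (j + 1) (YY F q (μ + 1)) =
    PowerSeries.coeff (j + 1) (YY F q μ) - X ^ q ^ μ * PowerSeries.coeff j (YY F q μ) := by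
  have : YY F q (μ + 1) = YY F q μ - PowerSeries.C (X ^ q ^ μ) * (PowerSeries.X * YY F q μ) := by
    rw [YY, Finset.prod_range_succ, ← YY]; ring
  rw [this, map_sub, PowerSeries.coeff_C_mul, PowerSeries.coeff_succ_X_mul]

lemma YY_coeff_zero (q μ : ℕ) : PowerSeries.coeff 0 (YY F q μ) = 1 := by
  simp [YY, map_prod]

lemma YY_degree {q : ℕ} (hq : 2 ≤ q) : ∀ μ j : ℕ,
    (j ≤ μ → (PowerSeries.coeff j (YY F q μ)).degree = (vv q μ j : ℕ)) ∧
    (μ < j → PowerSeries.coeff j (YY F q μ) = 0) := by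
  intro μ
  induction μ with
  | zero =>
    intro j
    refine ⟨fun hj => ?_, fun hj => ?_⟩
    · obtain rfl : j = 0 := by omega
      rw [YY_coeff_zero]; simp [vv]
    · simp [YY, PowerSeries.coeff_one, show j ≠ 0 by omega]
  | succ μ ih =>
    intro j
    rcases j with _ | j
    · rw [YY_coeff_zero]; simp [vv]
    · rw [YY_coeff_succ]
      refine ⟨fun hj => ?_, fun hj => ?_⟩
      · have h1 := (ih j).1 (by omega)
        have h2 : (X ^ q ^ μ * PowerSeries.coeff j (YY F q μ)).degree = ((vv q (μ + 1) (j + 1) : ℕ) : WithBot ℕ) := by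
          rw [degree_mul, h1, degree_X_pow, vv_succ_succ]; push_cast; rfl
        rw [degree_sub_eq_right_of_degree_lt, h2]
        rw [h2]
        by_cases hj2 : j + 1 ≤ μ
        · rw [(ih (j + 1)).1 hj2, vv_succ_succ]
          have := vv_lt hq μ (j + 1) hj2
          exact_mod_cast (by omega : vv q μ (j + 1) < q ^ μ + vv q μ j)
        · rw [(ih (j + 1)).2 (by omega), degree_zero]
          exact WithBot.bot_lt_coe _
      · rw [(ih (j + 1)).2 (by omega), (ih j).2 (by omega)]; simp

lemma coeff_bound_mul (N : ℕ) (f g : PowerSeries F[X])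
    (hf : ∀ j, (PowerSeries.coeff j f).natDegree ≤ j * N)
    (hg : ∀ j, (PowerSeries.coeff j g).natDegree ≤ j * N) (j : ℕ) :
    (PowerSeries.coeff j (f * g)).natDegree ≤ j * N := by
  rw [PowerSeries.coeff_mul]
  apply natDegree_sum_le_of_forall_le
  rintro ⟨a, b⟩ hab
  rw [Finset.HasAntidiagonal.mem_antidiagonal] at hab
  refine natDegree_mul_le.trans ?_
  have := hf a
  have := hg b
  simp only at hab ⊢
  subst hab
  nlinarith

lemma ZZ_bound {q : ℕ} (hq : 1 ≤ q) (N μ : ℕ) (hN : ∀ i < μ, q ^ i ≤ N) (j : ℕ) :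
    (PowerSeries.coeff j (ZZ F q μ)).natDegree ≤ j * N := by
  induction μ generalizing j with
  | zero => simp [ZZ, PowerSeries.coeff_one]; split_ifs <;> simp
  | succ μ ih =>
    rw [ZZ, Finset.prod_range_succ, ← ZZ]
    apply coeff_bound_mul
    · exact fun j => ih (fun i hi => hN i (by omega)) j
    · intro j
      rw [PowerSeries.coeff_mk, ← pow_mul, natDegree_X_pow, mul_comm]
      exact Nat.mul_le_mul_left _ (hN μ (by omega))

lemma cZZ_bound {q : ℕ} (hq : 1 ≤ q) (μ : ℕ) (c : F[X]) (j : ℕ) :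
    (PowerSeries.coeff j (PowerSeries.map C (c : PowerSeries F) * ZZ F q μ)).natDegree ≤ j * q ^ μ := by
  apply coeff_bound_mul
  · intro j; simp
  · exact ZZ_bound hq _ _ (fun i hi => Nat.pow_le_pow_right hq (by omega))

end stepanov

section point
variable {F : Type*} [Field F] [Fintype F]

lemma frob_pow_apply {L : Type*} [Field L] [Algebra F L] (i : ℕ) (x : L) :
    (FiniteField.frobeniusAlgHom F L ^ i) x = x ^ (Fintype.card F ^ i) := by
  rw [AlgHom.coe_pow, FiniteField.coe_frobeniusAlgHom, pow_iterate]

lemma reverse_prod_X_sub_C {L : Type*} [Field L] (b : ℕ → L) (n : ℕ) :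
    (∏ i ∈ Finset.range n, (X - C (b i))).reverse = ∏ i ∈ Finset.range n, (1 - C (b i) * X) := by
  induction n with
  | zero => simp only [Finset.range_zero, Finset.prod_empty]; rw [← C_1, reverse_C]
  | succ n ih =>
    rw [Finset.prod_range_succ, Finset.prod_range_succ, reverse_mul_of_domain, ih]
    congr 1
    rw [reverse, natDegree_X_sub_C, reflect_sub, reflect_one_X, reflect_C, pow_one]

lemma prod_periodic {M : Type*} [CommMonoid M] (b : ℕ → M) (d j : ℕ) (hb : ∀ i, b (d + i) = b i) :
    ∏ i ∈ Finset.range (d * j), b i = (∏ i ∈ Finset.range d, b i) ^ j := by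
  have hb' : ∀ j i, b (d * j + i) = b i := by
    intro j
    induction j with
    | zero => simp
    | succ j ih => intro i; rw [show d * (j + 1) + i = d + (d * j + i) by ring, hb, ih]
  induction j with
  | zero => simp
  | succ j ih =>
    rw [mul_add, mul_one, Finset.prod_range_add, ih, pow_succ]
    congr 1
    exact Finset.prod_congr rfl fun i _ => hb' j i

lemma point_facts_aux {L : Type*} [Field L] [Algebra F L] [Finite L] (a : L) {P : F[X]} (hm : P.Monic)
    (hd : 0 < P.natDegree) (haP : aeval a P = 0) (hfr : Module.finrank F L = P.natDegree)
    (hext : ∀ f g : L →ₐ[F] L, f a = g a → f = g) {ν : ℕ} (hν : P.natDegree ∣ ν) :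
    a ^ (Fintype.card F ^ ν) = a ∧
    (P.reverse ^ (ν / P.natDegree)).map (algebraMap F L) =
      ∏ i ∈ Finset.range ν, (1 - C (a ^ (Fintype.card F ^ i)) * X) := by
  classical
  have hord : orderOf (FiniteField.frobeniusAlgHom F L) = P.natDegree := by
    rw [FiniteField.orderOf_frobeniusAlgHom, hfr]
  have hper : a ^ (Fintype.card F ^ P.natDegree) = a := by
    rw [← frob_pow_apply, ← hord, pow_orderOf_eq_one]; rfl
  have hper' : ∀ i, a ^ (Fintype.card F ^ (P.natDegree + i)) = a ^ (Fintype.card F ^ i) := by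
    intro i; rw [pow_add, pow_mul, hper]
  have hinj : Set.InjOn (fun i => a ^ (Fintype.card F ^ i)) (Finset.range P.natDegree : Set ℕ) := by
    intro i hi' j hj hij
    simp only [Finset.coe_range, Set.mem_Iio] at hi' hj
    have h1 : FiniteField.frobeniusAlgHom F L ^ i = FiniteField.frobeniusAlgHom F L ^ j := by
      apply hext
      rw [frob_pow_apply, frob_pow_apply]
      exact hij
    exact pow_injOn_Iio_orderOf (by simpa [hord] using hi') (by simpa [hord] using hj) h1
  have hroot : ∀ i, (P.map (algebraMap F L)).eval (a ^ (Fintype.card F ^ i)) = 0 := by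
    intro i
    rw [← frob_pow_apply, eval_map_algebraMap, aeval_algHom_apply, haP, map_zero]
  have hmon : ∀ i ∈ Finset.range P.natDegree, (X - C (a ^ (Fintype.card F ^ i))).Monic :=
    fun i _ => monic_X_sub_C _
  have hfact : P.map (algebraMap F L) =
      ∏ i ∈ Finset.range P.natDegree, (X - C (a ^ (Fintype.card F ^ i))) := by
    apply eq_of_monic_of_dvd_of_natDegree_le
    · exact monic_prod_of_monic _ _ hmon
    · exact hm.map _
    · apply Finset.prod_dvd_of_coprime
      · intro i hi' j hj hij
        apply isCoprime_X_sub_C_of_isUnit_sub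
        rw [isUnit_iff_ne_zero, sub_ne_zero]
        exact fun h => hij (hinj hi' hj h)
      · intro i _
        rw [dvd_iff_isRoot]
        exact hroot i
    · rw [natDegree_prod_of_monic _ _ hmon, natDegree_map]
      simp only [natDegree_X_sub_C, Finset.sum_const, Finset.card_range, smul_eq_mul, mul_one, le_refl]
  obtain ⟨j, rfl⟩ := hν
  constructor
  · have : ∀ j, a ^ (Fintype.card F ^ (P.natDegree * j)) = a := by
      intro j
      induction j with
      | zero => simp
      | succ j ih => rw [mul_add, mul_one, add_comm, hper', ih]
    exact this j
  · rw [Nat.mul_div_cancel_left _ hd, prod_periodic _ _ _ (fun i => by rw [hper']),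
      ← reverse_prod_X_sub_C, ← hfact, Polynomial.map_pow]
    congr 1
    rw [reverse, reverse, natDegree_map, reflect_map]

lemma point_facts {P : F[X]} (hm : P.Monic) [hi : Fact (Irreducible P)] {ν : ℕ}
    (hν : P.natDegree ∣ ν) :
    (AdjoinRoot.root P) ^ (Fintype.card F ^ ν) = AdjoinRoot.root P ∧
    (P.reverse ^ (ν / P.natDegree)).map (algebraMap F (AdjoinRoot P)) =
      ∏ i ∈ Finset.range ν, (1 - C ((AdjoinRoot.root P) ^ (Fintype.card F ^ i)) * X) := by
  have h1 : Module.Finite F (AdjoinRoot P) := (AdjoinRoot.powerBasis hi.1.ne_zero).finite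
  have h2 : Finite (AdjoinRoot P) := Module.finite_of_finite F
  refine point_facts_aux (AdjoinRoot.root P) hm hi.1.natDegree_pos ?_ ?_ ?_ hν
  · rw [AdjoinRoot.aeval_eq, AdjoinRoot.mk_self]
  · rw [(AdjoinRoot.powerBasis hi.1.ne_zero).finrank, AdjoinRoot.powerBasis_dim]
  · intro f g hfg
    exact AdjoinRoot.algHom_ext hfg

end point

section stepmain
variable {F : Type*} [Field F] [Fintype F]

/-- values of the `y_j` at a point, raised to the `q^μ` -/
lemma y_frob {L : Type*} [Field L] [Algebra F L] (a : L) (μ m : ℕ) (c : F[X]) (N : F[X])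
    (hN : N.map (algebraMap F L) =
      ∏ i ∈ Finset.range (2 * μ), (1 - C (a ^ (Fintype.card F ^ i)) * X))
    (hc : ∀ i ≤ m, N.coeff i = c.coeff i) (j : ℕ) (hj : j ≤ m) :
    (FiniteField.frobeniusAlgHom F L ^ μ)
        (aeval a (PowerSeries.coeff j (YY F (Fintype.card F) μ))) =
      aeval a (PowerSeries.coeff j
        (PowerSeries.map C (c : PowerSeries F) * ZZ F (Fintype.card F) μ)) := by
  set q := Fintype.card F with hq
  set ev : F[X] →+* L := (aeval a : F[X] →ₐ[F] L).toRingHom with hev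
  have hevx : ∀ f, aeval a f = ev f := fun f => rfl
  set φ : L →+* L := (FiniteField.frobeniusAlgHom F L ^ μ).toRingHom with hφ
  have hφx : ∀ x, (FiniteField.frobeniusAlgHom F L ^ μ) x = φ x := fun x => rfl
  have hφx' : ∀ x, φ x = x ^ q ^ μ := fun x => frob_pow_apply μ x
  rw [hevx, hevx, hφx, ← PowerSeries.coeff_map, ← PowerSeries.coeff_map, ← PowerSeries.coeff_map]
  have e1 : PowerSeries.map ev (YY F q μ) =
      ∏ i ∈ Finset.range μ, (1 - PowerSeries.C (a ^ q ^ i) * PowerSeries.X) := by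
    simp only [YY, map_prod, map_sub, map_one, map_mul, PowerSeries.map_C, PowerSeries.map_X]
    refine Finset.prod_congr rfl fun i _ => ?_
    simp [hev]
  have e2 : PowerSeries.map φ (PowerSeries.map ev (YY F q μ)) =
      ∏ i ∈ Finset.range μ, (1 - PowerSeries.C (a ^ q ^ (μ + i)) * PowerSeries.X) := by
    rw [e1]
    simp only [map_prod, map_sub, map_one, map_mul, PowerSeries.map_C, PowerSeries.map_X]
    refine Finset.prod_congr rfl fun i _ => ?_
    rw [hφx', ← pow_mul, ← pow_add, add_comm i μ]
  have e3 : PowerSeries.map ev (YY F q μ) * PowerSeries.map φ (PowerSeries.map ev (YY F q μ)) =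
      ((N.map (algebraMap F L) : L[X]) : PowerSeries L) := by
    rw [e2, e1, ← Finset.prod_range_add (fun i => (1 - PowerSeries.C (a ^ q ^ i) * PowerSeries.X)),
      ← two_mul, hN]
    rw [← Polynomial.coeToPowerSeries.ringHom_apply, map_prod]
    refine Finset.prod_congr rfl fun i _ => ?_
    simp
  have e4 : PowerSeries.map φ (PowerSeries.map ev (YY F q μ)) =
      ((N.map (algebraMap F L) : L[X]) : PowerSeries L) * PowerSeries.map ev (ZZ F q μ) := by
    have h1 : PowerSeries.map ev (YY F q μ) * PowerSeries.map ev (ZZ F q μ) = 1 := by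
      rw [← map_mul, YY_mul_ZZ, map_one]
    rw [← e3]
    linear_combination -(PowerSeries.map φ (PowerSeries.map ev (YY F q μ))) * h1
  rw [e4, map_mul (PowerSeries.map ev), PowerSeries.coeff_mul, PowerSeries.coeff_mul]
  refine Finset.sum_congr rfl fun x hx => ?_
  rw [Finset.HasAntidiagonal.mem_antidiagonal] at hx
  congr 1
  rw [PowerSeries.coeff_map, PowerSeries.coeff_map, Polynomial.coeff_coe, Polynomial.coeff_coe,
    coeff_map, hc _ (by omega)]
  simp [hev]

/-- auxiliary family -/
noncomputable def Sfam (q μ m D B : ℕ) (i : Fin D × Fin B × (Fin m → Fin q)) : F[X] :=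
  X ^ (i.1 : ℕ) * X ^ (q ^ μ * (i.2.1 : ℕ)) *
    ∏ j : Fin m, (PowerSeries.coeff ((j : ℕ) + 1) (YY F q μ)) ^ (i.2.2 j : ℕ)

noncomputable def Tfam (c : F[X]) (q μ m D B : ℕ) (i : Fin D × Fin B × (Fin m → Fin q)) : F[X] :=
  X ^ (q ^ μ * (i.1 : ℕ)) * X ^ (i.2.1 : ℕ) *
    ∏ j : Fin m, (PowerSeries.coeff ((j : ℕ) + 1)
      (PowerSeries.map C (c : PowerSeries F) * ZZ F q μ)) ^ (i.2.2 j : ℕ)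

omit [Fintype F] in
lemma Sfam_degree {q : ℕ} (hq : 2 ≤ q) {μ m : ℕ} (hm : m ≤ μ) (D B : ℕ)
    (i : Fin D × Fin B × (Fin m → Fin q)) :
    (Sfam (F := F) q μ m D B i).degree =
      (((i.1 : ℕ) + q ^ μ * (i.2.1 : ℕ) + ∑ j : Fin m, (i.2.2 j : ℕ) * vv q μ ((j : ℕ) + 1) : ℕ) :
        WithBot ℕ) := by
  rw [Sfam, degree_mul, degree_mul, degree_X_pow, degree_X_pow, degree_prod]
  push_cast
  congr 1
  refine Finset.sum_congr rfl fun j _ => ?_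
  rw [degree_pow, (YY_degree hq μ _).1 (by omega), nsmul_eq_mul]

omit [Fintype F] in
lemma Sfam_inj {q : ℕ} (hq : 2 ≤ q) {μ m : ℕ} (hm : m ≤ μ) (B : ℕ) :
    Function.Injective fun i => (Sfam (F := F) q μ m (q ^ (μ - m)) B i).degree := by
  rintro ⟨k, e0, e⟩ ⟨k', e0', e'⟩ h
  simp only [Sfam_degree hq hm] at h
  have h := WithBot.coe_injective h
  let g : (Fin m → Fin q) → ℕ → ℕ := fun e j => if hj : j < m then (e ⟨j, hj⟩ : ℕ) else 0
  have hg : ∀ e : Fin m → Fin q, ∑ j : Fin m, (e j : ℕ) * vv q μ ((j : ℕ) + 1) =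
      ∑ j ∈ Finset.range m, g e j * vv q μ (j + 1) := by
    intro e
    rw [Finset.sum_range]
    refine Finset.sum_congr rfl fun j _ => by simp [g]
  have hgl : ∀ e, ∀ j < m, g e j < q := by
    intro e j hj
    simp [g, hj]
  simp only [hg] at h
  obtain ⟨h1, h2, h3⟩ := digits_inj hq μ m hm k k' e0 e0' (g e) (g e') k.2 k'.2 (hgl e) (hgl e') h
  have h4 : e = e' := by
    funext j
    have := h3 j j.2
    simp only [g, j.2, dif_pos] at this
    exact Fin.ext this
  rw [Fin.ext h1, Fin.ext h2, h4]

omit [Fintype F] in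
lemma Sfam_natDegree_le {q : ℕ} (hq : 2 ≤ q) {μ m : ℕ} (hm : m ≤ μ) (D B : ℕ)
    (i : Fin D × Fin B × (Fin m → Fin q)) :
    (Sfam (F := F) q μ m D B i).natDegree ≤ D + q ^ μ * B + m * (q * q ^ μ) := by
  rw [natDegree_eq_of_degree_eq_some (Sfam_degree hq hm D B i)]
  have h1 : ∑ j : Fin m, (i.2.2 j : ℕ) * vv q μ ((j : ℕ) + 1) ≤ m * (q * q ^ μ) := by
    refine (Finset.sum_le_card_nsmul _ _ (q * q ^ μ) fun j _ => ?_).trans (by simp)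
    exact Nat.mul_le_mul (i.2.2 j).2.le (vv_lt hq μ _ (by omega)).le
  have h2 : q ^ μ * (i.2.1 : ℕ) ≤ q ^ μ * B := Nat.mul_le_mul_left _ i.2.1.2.le
  have := i.1.2
  omega

omit [Fintype F] in
lemma Tfam_natDegree_lt (c : F[X]) {q : ℕ} (hq : 2 ≤ q) {μ m : ℕ} (D B : ℕ)
    (i : Fin D × Fin B × (Fin m → Fin q)) :
    (Tfam c q μ m D B i).natDegree < q ^ μ * (D - 1) + B + q * m ^ 2 * q ^ μ := by
  have h1 : (∏ j : Fin m, (PowerSeries.coeff ((j : ℕ) + 1)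
      (PowerSeries.map C (c : PowerSeries F) * ZZ F q μ)) ^ (i.2.2 j : ℕ)).natDegree ≤
      q * m ^ 2 * q ^ μ := by
    refine (natDegree_prod_le _ _).trans ?_
    refine (Finset.sum_le_card_nsmul _ _ (q * (m * q ^ μ)) fun j _ => ?_).trans
      (le_of_eq (by simp; ring))
    refine natDegree_pow_le.trans (Nat.mul_le_mul (i.2.2 j).2.le ?_)
    refine (cZZ_bound (by omega) μ c _).trans (Nat.mul_le_mul_right _ ?_)
    omega
  have h2 : (Tfam c q μ m D B i).natDegree ≤ q ^ μ * (i.1 : ℕ) + (i.2.1 : ℕ) + q * m ^ 2 * q ^ μ := by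
    refine natDegree_mul_le.trans (add_le_add (natDegree_mul_le.trans ?_) h1)
    simp
  have h3 : q ^ μ * (i.1 : ℕ) ≤ q ^ μ * (D - 1) := Nat.mul_le_mul_left _ (by have := i.1.2; omega)
  have := i.2.1.2
  omega

lemma stepanov (m μ : ℕ) (c : F[X]) (hm : m ≤ μ)
    (hμ : (Fintype.card F) ^ (μ - m) + Fintype.card F * m ^ 2 < (Fintype.card F) ^ μ)
    (T : Finset F[X])
    (hT : ∀ P ∈ T, P.Monic ∧ Irreducible P ∧ P.natDegree ∣ 2 * μ ∧
      ∀ i ≤ m, (P.reverse ^ (2 * μ / P.natDegree)).coeff i = c.coeff i) :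
    ∑ P ∈ T, P.natDegree ≤ (Fintype.card F) ^ (2 * μ - m) +
      (1 + Fintype.card F * m ^ 2 + m * Fintype.card F) * (Fintype.card F) ^ μ := by
  classical
  set q := Fintype.card F with hqdef
  have hq : 2 ≤ q := Fintype.one_lt_card
  set D := q ^ (μ - m) with hD
  set B := D + q * m ^ 2 with hB
  set Nc := q ^ μ * (D - 1) + B + q * m ^ 2 * q ^ μ with hNc
  have hD0 : 0 < D := by positivity
  let Φ : ((Fin D × Fin B × (Fin m → Fin q)) → F) →ₗ[F] degreeLT F Nc :=
    LinearMap.codRestrict _ (Fintype.linearCombination F (Tfam c q μ m D B)) (by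
      intro u
      rw [Fintype.linearCombination_apply]
      refine Submodule.sum_mem _ fun i _ => Submodule.smul_mem _ _ ?_
      rw [mem_degreeLT]
      refine degree_le_natDegree.trans_lt ?_
      exact_mod_cast Tfam_natDegree_lt c hq D B i)
  have hker : LinearMap.ker Φ ≠ ⊥ := by
    apply LinearMap.ker_ne_bot_of_finrank_lt
    have e1 : Module.finrank F (degreeLT F Nc) = Nc := by
      rw [(degreeLTEquiv F Nc).finrank_eq]; simp
    rw [e1]
    simp only [Module.finrank_fintype_fun_eq_card, Fintype.card_prod, Fintype.card_fin,
      Fintype.card_fun]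
    have e2 : D * (B * q ^ m) = B * q ^ μ := by
      have : D * q ^ m = q ^ μ := by rw [hD, ← pow_add]; congr 1; omega
      rw [← this]; ring
    rw [e2, hNc]
    have e3 : B * q ^ μ = D * q ^ μ + q * m ^ 2 * q ^ μ := by rw [hB]; ring
    have e4 : D * q ^ μ = q ^ μ * (D - 1) + q ^ μ := by
      obtain ⟨k, hk⟩ : ∃ k, D = k + 1 := ⟨D - 1, by omega⟩
      rw [hk, Nat.add_sub_cancel]; ring
    omega
  obtain ⟨u, hu, hu0⟩ := Submodule.exists_mem_ne_zero_of_ne_bot hker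
  have huT : ∑ i, u i • Tfam c q μ m D B i = 0 := by
    have := congrArg Subtype.val (LinearMap.mem_ker.mp hu)
    simpa [Φ, Fintype.linearCombination_apply] using this
  set H : F[X] := ∑ i, u i • Sfam q μ m D B i with hH
  have hH0 : H ≠ 0 := by
    intro h0
    have h1 : H.degree = Finset.univ.sup fun i => (u i • Sfam (F := F) q μ m D B i).degree := by
      apply degree_sum_eq_of_disjoint
      intro i hi j hj hij
      simp only [Function.onFun, Function.comp]
      have hui : u i ≠ 0 := fun h => hi.2 (by rw [h, zero_smul])
      have huj : u j ≠ 0 := fun h => hj.2 (by rw [h, zero_smul])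
      rw [smul_eq_C_mul, smul_eq_C_mul, degree_C_mul hui, degree_C_mul huj]
      exact fun h => hij (Sfam_inj hq hm B h)
    apply hu0
    funext i
    by_contra hui
    have h2 := Finset.le_sup (f := fun i => (u i • Sfam (F := F) q μ m D B i).degree)
      (Finset.mem_univ i)
    rw [← h1, h0, degree_zero, le_bot_iff] at h2
    simp only [smul_eq_C_mul, degree_C_mul hui, Sfam_degree hq hm] at h2
    exact WithBot.coe_ne_bot h2
  have hdvd : ∀ P ∈ T, P ∣ H := by
    intro P hP
    obtain ⟨h1, h2, h3, h4⟩ := hT P hP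
    haveI : Fact (Irreducible P) := ⟨h2⟩
    obtain ⟨p1, p2⟩ := point_facts h1 h3
    rw [← AdjoinRoot.mk_eq_zero, ← AdjoinRoot.aeval_eq]
    generalize hL : AdjoinRoot.root P = a at *
    have hinj : Function.Injective (FiniteField.frobeniusAlgHom F (AdjoinRoot P) ^ μ) :=
      RingHom.injective (FiniteField.frobeniusAlgHom F (AdjoinRoot P) ^ μ).toRingHom
    apply hinj
    rw [map_zero]
    have key : ∀ i, (FiniteField.frobeniusAlgHom F (AdjoinRoot P) ^ μ)
        (aeval a (Sfam (F := F) q μ m D B i)) = aeval a (Tfam c q μ m D B i) := by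
      intro i
      simp only [Sfam, Tfam, map_mul, map_prod, map_pow, aeval_X]
      congr 1
      · rw [frob_pow_apply, ← hqdef, ← pow_mul, ← pow_mul]
        congr 1
        have : a ^ (q ^ μ * (q ^ μ * (i.2.1 : ℕ))) = a ^ (i.2.1 : ℕ) := by
          rw [← mul_assoc, ← pow_add, ← two_mul, pow_mul, p1]
        exact this
      · refine Finset.prod_congr rfl fun j _ => ?_
        rw [y_frob a μ m c _ p2 h4 _ (by omega)]
    rw [hH]
    simp only [map_sum, map_smul, key]
    have := congrArg (aeval a) huT
    simpa only [map_sum, map_smul, map_zero] using this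
  have hprod : ∏ P ∈ T, P ∣ H := by
    apply Finset.prod_dvd_of_coprime
    · intro P hP Q hQ hPQ
      obtain ⟨h1, h2, -⟩ := hT P hP
      obtain ⟨h1', h2', -⟩ := hT Q hQ
      simp only [Function.onFun]
      rw [h2.coprime_iff_not_dvd]
      intro hd
      have := (h2.dvd_irreducible_iff_associated h2').mp hd
      exact hPQ (eq_of_monic_of_associated h1 h1' this)
    · exact hdvd
  have h5 := natDegree_le_of_dvd hprod hH0
  rw [natDegree_prod_of_monic _ _ fun P hP => (hT P hP).1] at h5
  refine h5.trans ?_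
  have h6 : H.natDegree ≤ D + q ^ μ * B + m * (q * q ^ μ) := by
    apply natDegree_sum_le_of_forall_le
    intro i _
    exact (natDegree_smul_le _ _).trans (Sfam_natDegree_le hq hm D B i)
  refine h6.trans ?_
  have h7 : q ^ μ * D = q ^ (2 * μ - m) := by
    rw [hD, ← pow_add]; congr 1; omega
  have h8 : D ≤ q ^ μ := Nat.pow_le_pow_right (by omega) (by omega)
  rw [← h7, hB]
  nlinarith

end stepmain

section grp
variable (F : Type*) [Field F] [Fintype F]

/-- truncated polynomial ring -/
abbrev TA (m : ℕ) : Type _ := AdjoinRoot (X ^ (m + 1) : F[X])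

/-- evaluation at zero -/
noncomputable def tev (m : ℕ) : TA F m →+* F :=
  AdjoinRoot.lift (RingHom.id F) 0 (by simp)

/-- the group of truncated 1-units -/
abbrev GG (m : ℕ) : Type _ := (Units.map (tev F m : TA F m →* F)).ker

instance TA_finite (m : ℕ) : Finite (TA F m) := by
  have : Module.Finite F (TA F m) := (monic_X_pow (m + 1)).finite_adjoinRoot
  exact Module.finite_of_finite F

noncomputable instance GG_fintype (m : ℕ) : Fintype (GG F m) := Fintype.ofFinite _

variable {F}

lemma tev_mk (m : ℕ) (P : F[X]) : tev F m (AdjoinRoot.mk _ P) = P.coeff 0 := by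
  rw [tev, AdjoinRoot.lift_mk, coeff_zero_eq_eval_zero]; simp [eval₂_eq_eval_map]

lemma isUnit_mk (m : ℕ) {P : F[X]} (h : P.coeff 0 = 1) :
    IsUnit (AdjoinRoot.mk (X ^ (m + 1) : F[X]) P) := by
  have h1 : X ∣ P - 1 := by rw [X_dvd_iff]; simp [h]
  have h2 : IsNilpotent (AdjoinRoot.mk (X ^ (m + 1) : F[X]) (P - 1)) := by
    refine ⟨m + 1, ?_⟩
    rw [← map_pow, AdjoinRoot.mk_eq_zero]
    exact pow_dvd_pow_of_dvd h1 _
  have := h2.isUnit_one_add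
  simpa using this

open Classical in
/-- class of a polynomial with constant term 1 -/
noncomputable def cl (m : ℕ) (P : F[X]) : GG F m :=
  if h : P.coeff 0 = 1 then ⟨(isUnit_mk m h).unit, by
    rw [MonoidHom.mem_ker]; ext; simp [tev_mk, h]⟩ else 1

lemma cl_coe (m : ℕ) {P : F[X]} (h : P.coeff 0 = 1) :
    ((cl m P : (TA F m)ˣ) : TA F m) = AdjoinRoot.mk _ P := by
  simp [cl, h]

lemma cl_one (m : ℕ) : cl m (1 : F[X]) = 1 := by
  ext; rw [cl_coe]; simp; simp

lemma cl_mul (m : ℕ) {P Q : F[X]} (h : P.coeff 0 = 1) (h' : Q.coeff 0 = 1) :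
    cl m (P * Q) = cl m P * cl m Q := by
  ext
  rw [cl_coe _ (by simp [mul_coeff_zero, h, h'])]
  simp [cl_coe, h, h']

lemma cl_pow (m : ℕ) {P : F[X]} (h : P.coeff 0 = 1) (j : ℕ) :
    cl m (P ^ j) = cl m P ^ j := by
  ext
  rw [cl_coe _ (by rw [coeff_zero_eq_eval_zero] at h ⊢; simp [h])]
  simp [cl_coe, h]

lemma cl_eq_iff (m : ℕ) {P Q : F[X]} (h : P.coeff 0 = 1) (h' : Q.coeff 0 = 1) :
    cl m P = cl m Q ↔ ∀ i ≤ m, P.coeff i = Q.coeff i := by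
  rw [← Subtype.coe_inj, ← Units.val_inj, cl_coe m h, cl_coe m h', AdjoinRoot.mk_eq_mk,
    X_pow_dvd_iff]
  simp only [coeff_sub, sub_eq_zero, Nat.lt_succ_iff]

lemma cl_surj (m : ℕ) (g : GG F m) : ∃ P : F[X], P.coeff 0 = 1 ∧ P.natDegree ≤ m ∧ cl m P = g := by
  obtain ⟨Q, hQ⟩ := AdjoinRoot.mk_surjective ((g : (TA F m)ˣ) : TA F m)
  have hmon : (X ^ (m + 1) : F[X]).Monic := monic_X_pow _
  have e : AdjoinRoot.mk (X ^ (m + 1) : F[X]) (Q %ₘ X ^ (m + 1)) = (g : (TA F m)ˣ) := by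
    rw [← hQ, AdjoinRoot.mk_eq_mk, ← dvd_neg, neg_sub]
    exact ⟨Q /ₘ X ^ (m + 1), by have := modByMonic_add_div Q (X ^ (m + 1) : F[X]); linear_combination -this⟩
  have h0 : (Q %ₘ X ^ (m + 1)).coeff 0 = 1 := by
    rw [← tev_mk m, e]
    have := g.2
    rw [MonoidHom.mem_ker] at this
    have := congrArg Units.val this
    simpa using this
  refine ⟨Q %ₘ X ^ (m + 1), h0, ?_, ?_⟩
  · have := natDegree_modByMonic_lt Q hmon (by intro h; simpa using congrArg natDegree h)
    simp at this; omega
  · ext; rw [cl_coe _ h0, e]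

/-- class of a monic polynomial -/
noncomputable def cls (m : ℕ) (h : F[X]) : GG F m := cl m h.reverse

lemma rev0 {h : F[X]} (hh : h.Monic) : h.reverse.coeff 0 = 1 := by
  rw [coeff_zero_reverse]; exact hh

lemma cls_one (m : ℕ) : cls m (1 : F[X]) = 1 := by
  rw [cls, ← C_1, reverse_C, C_1, cl_one]

lemma cls_mul (m : ℕ) {f g : F[X]} (hf : f.Monic) (hg : g.Monic) :
    cls m (f * g) = cls m f * cls m g := by
  rw [cls, reverse_mul_of_domain, cl_mul m (rev0 hf) (rev0 hg)]; rfl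

lemma cls_eq_iff (m n : ℕ) (hn : m ≤ n) {f h : F[X]} (hf : f.Monic) (hh : h.Monic)
    (hfn : f.natDegree = n) (hhn : h.natDegree = n) :
    cls m h = cls m f ↔ (h - f).degree < ((n - m : ℕ) : WithBot ℕ) := by
  rw [cls, cls, cl_eq_iff m (rev0 hh) (rev0 hf), degree_lt_iff_coeff_zero]
  constructor
  · intro H j hj
    by_cases hjn : j ≤ n
    · have := H (n - j) (by omega)
      rw [coeff_reverse, coeff_reverse, hfn, hhn, revAt_le (by omega),
        show n - (n - j) = j by omega] at this
      rw [coeff_sub, this, sub_self]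
    · rw [coeff_sub, coeff_eq_zero_of_natDegree_lt (by omega), coeff_eq_zero_of_natDegree_lt (by omega), sub_self]
  · intro H i hi
    rw [coeff_reverse, coeff_reverse, hfn, hhn, revAt_le (by omega)]
    have := H (n - i) (by omega)
    rwa [coeff_sub, sub_eq_zero] at this

lemma cls_surj (m n : ℕ) (hn : m ≤ n) (g : GG F m) : ∃ f ∈ Mon F n, cls m f = g := by
  obtain ⟨P, h0, hd, hP⟩ := cl_surj m g
  have hc : (reflect n P).coeff n = 1 := by
    rw [coeff_reflect, revAt_le le_rfl]; simpa using h0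
  have hle : (reflect n P).natDegree ≤ n := by
    rw [natDegree_le_iff_coeff_eq_zero]
    intro N hN
    rw [coeff_reflect, revAt_eq_self_of_lt hN]
    exact coeff_eq_zero_of_natDegree_lt (by omega)
  have hnd : (reflect n P).natDegree = n :=
    le_antisymm hle (le_natDegree_of_ne_zero (by rw [hc]; exact one_ne_zero))
  refine ⟨reflect n P, mem_Mon.2 ⟨?_, hnd⟩, ?_⟩
  · rw [Monic, leadingCoeff, hnd, hc]
  · rw [cls, reverse, hnd, show reflect n (reflect n P) = P by ext i; simp [coeff_reflect], hP]

open Classical in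
lemma cls_fiber (m n : ℕ) (hn : m ≤ n) (g : GG F m) :
    ((Mon F n).filter fun h => cls m h = g).card = Fintype.card F ^ (n - m) := by
  obtain ⟨f0, hf0, hg⟩ := cls_surj m n hn g
  rw [mem_Mon] at hf0
  rw [← card_Mon]
  symm
  apply Finset.card_bij (fun u _ => f0 + (u - X ^ (n - m)))
  · intro u hu
    rw [mem_Mon] at hu
    have hlt : (u - X ^ (n - m)).degree < ((n - m : ℕ) : WithBot ℕ) := by
      have := degree_sub_lt_left (p := u) (q := X ^ (n - m)) (by
        rw [degree_X_pow, degree_eq_natDegree hu.1.ne_zero, hu.2]) hu.1.ne_zero (by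
        rw [hu.1.leadingCoeff, (monic_X_pow _).leadingCoeff])
      rwa [degree_eq_natDegree hu.1.ne_zero, hu.2] at this
    have hlt2 : (u - X ^ (n - m)).degree < f0.degree := by
      rw [degree_eq_natDegree hf0.1.ne_zero, hf0.2]
      exact hlt.trans_le (by exact_mod_cast Nat.sub_le n m)
    have h1 : (f0 + (u - X ^ (n - m))).Monic := hf0.1.add_of_left hlt2
    have h2 : (f0 + (u - X ^ (n - m))).natDegree = n := by
      rw [natDegree_add_eq_left_of_degree_lt hlt2, hf0.2]
    rw [Finset.mem_filter, mem_Mon]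
    refine ⟨⟨h1, h2⟩, ?_⟩
    rw [← hg, cls_eq_iff m n hn hf0.1 h1 hf0.2 h2]
    simpa using hlt
  · intro u _ v _ h
    simpa using h
  · intro h hh
    rw [Finset.mem_filter, mem_Mon, ← hg] at hh
    obtain ⟨⟨h1, h2⟩, h3⟩ := hh
    rw [cls_eq_iff m n hn hf0.1 h1 hf0.2 h2] at h3
    have h3' : (h - f0).degree < (X ^ (n - m) : F[X]).degree := by rwa [degree_X_pow]
    refine ⟨X ^ (n - m) + (h - f0), mem_Mon.2 ⟨(monic_X_pow _).add_of_left h3', ?_⟩, by ring⟩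
    rw [natDegree_add_eq_left_of_degree_lt h3', natDegree_X_pow]

lemma card_GG (m : ℕ) : Fintype.card (GG F m) = Fintype.card F ^ m := by
  classical
  have := Finset.card_eq_sum_card_fiberwise (s := Mon F m) (t := Finset.univ) (f := cls m) (by simp)
  rw [card_Mon] at this
  rw [this, Finset.sum_congr rfl (fun g _ => cls_fiber m m le_rfl g)]
  simp

end grp

section weilroots

lemma exists_omega (A : ℕ → ℂ) (N : ℕ) (h0 : A 0 = 1) (hA : ∀ n, N < n → A n = 0) :
    ∃ ω : Fin N → ℂ, ∀ n, A n = (-1) ^ n * ∑ D ∈ Finset.powersetCard n Finset.univ, ∏ i ∈ D, ω i := by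
  set P : ℂ[X] := ∑ n ∈ Finset.range (N + 1), C (A n) * X ^ (N - n) with hP
  have hc : ∀ n ≤ N, P.coeff (N - n) = A n := by
    intro n hn
    rw [hP, finsetSum_coeff, Finset.sum_eq_single n]
    · simp
    · intro b hb hbn
      rw [Finset.mem_range] at hb
      rw [coeff_C_mul, coeff_X_pow, if_neg (by omega), mul_zero]
    · intro h; rw [Finset.mem_range] at h; omega
  have hdeg : P.natDegree ≤ N := by
    apply natDegree_sum_le_of_forall_le
    intro n _
    exact (natDegree_C_mul_X_pow_le _ _).trans (Nat.sub_le _ _)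
  have hcN : P.coeff N = 1 := by have := hc 0 (by omega); rwa [h0, Nat.sub_zero] at this
  have hnd : P.natDegree = N :=
    le_antisymm hdeg (le_natDegree_of_ne_zero (by rw [hcN]; exact one_ne_zero))
  have hmon : P.Monic := by rw [Monic, leadingCoeff, hnd, hcN]
  have hcard : P.roots.card = P.natDegree := (IsAlgClosed.splits P).natDegree_eq_card_roots.symm
  have hlen : P.roots.toList.length = N := by rw [Multiset.length_toList, hcard, hnd]
  refine ⟨fun i => P.roots.toList.get (i.cast hlen.symm), fun n => ?_⟩
  have hroots : P.roots = Finset.univ.val.map (fun i : Fin N => P.roots.toList.get (i.cast hlen.symm)) := by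
    conv_lhs => rw [← Multiset.coe_toList P.roots]
    generalize P.roots.toList = l at hlen
    subst hlen
    simp
  rw [← Finset.esymm_map_val, ← hroots]
  by_cases hn : n ≤ N
  · rw [← hc n hn, coeff_eq_esymm_roots_of_card hcard (by omega), hmon.leadingCoeff, hnd,
      show N - (N - n) = n by omega, one_mul]
  · rw [hA n (by omega), Multiset.esymm, Multiset.powersetCard_eq_empty]
    · simp
    · rw [hcard, hnd]; omega

lemma weil_roots (A S : ℕ → ℂ) (N : ℕ) (h0 : A 0 = 1) (hA : ∀ n, N < n → A n = 0)
    (hconv : ∀ n : ℕ, (n : ℂ) * A n = ∑ ν ∈ Finset.Icc 1 n, S ν * A (n - ν))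
    (q K : ℝ) (hq : 0 < q) (μ0 : ℕ) (hS : ∀ μ, μ0 ≤ μ → ‖S (2 * μ)‖ ≤ K * q ^ μ) (n : ℕ) :
    ‖A n‖ ≤ (N.choose n : ℝ) * √q ^ n := by
  obtain ⟨ω, hω⟩ := exists_omega A N h0 hA
  have hconv' : ∀ n : ℕ, (n : ℂ) * A n = ∑ a ∈ Finset.range n, A a * S (n - a) := by
    intro n
    rw [hconv]
    refine Finset.sum_bij' (fun ν _ => n - ν) (fun a _ => n - a) ?_ ?_ ?_ ?_ ?_
    · intro ν hν; rw [Finset.mem_Icc] at hν; rw [Finset.mem_range]; omega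
    · intro ν hν; rw [Finset.mem_range] at hν; rw [Finset.mem_Icc]; omega
    · intro ν hν; rw [Finset.mem_Icc] at hν; omega
    · intro ν hν; rw [Finset.mem_range] at hν; omega
    · intro ν hν; rw [Finset.mem_Icc] at hν; rw [show n - (n - ν) = ν by omega, mul_comm]
  have hnew : ∀ n : ℕ, (n : ℂ) * A n = ∑ a ∈ Finset.range n, A a * (-∑ i, ω i ^ (n - a)) := by
    intro n
    have h := newton ω n
    rw [hω n, mul_left_comm, h, ← mul_assoc, ← pow_add,
      show n + (n + 1) = 2 * n + 1 by ring, pow_succ, pow_mul]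
    simp only [neg_one_sq, one_pow, one_mul, neg_mul, ← Finset.sum_neg_distrib, hω]
    refine Finset.sum_congr rfl fun a _ => ?_
    rw [Finset.sum_neg_distrib]
    ring
  have hSω : ∀ ν, 1 ≤ ν → S ν = -∑ i, ω i ^ ν := by
    intro ν
    induction ν using Nat.strong_induction_on with
    | _ ν ih =>
      intro hν
      obtain ⟨k, rfl⟩ : ∃ k, ν = k + 1 := ⟨ν - 1, by omega⟩
      have h := (hconv' (k + 1)).symm.trans (hnew (k + 1))
      rw [Finset.sum_range_succ', Finset.sum_range_succ'] at h
      have hs : ∑ a ∈ Finset.range k, A (a + 1) * S (k + 1 - (a + 1)) =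
          ∑ a ∈ Finset.range k, A (a + 1) * -∑ i, ω i ^ (k + 1 - (a + 1)) := by
        refine Finset.sum_congr rfl fun a ha => ?_
        rw [Finset.mem_range] at ha
        rw [ih (k + 1 - (a + 1)) (by omega) (by omega)]
      rw [hs] at h
      have h := add_left_cancel h
      simpa [h0] using h
  have hb : ∀ i, ‖ω i‖ ≤ √q := by
    intro i
    refine psum_bound ω q K hq (max μ0 1) ?_ i
    intro μ hμ
    have := hS μ (by omega)
    rwa [hSω _ (by omega), norm_neg] at this
  rw [hω n, norm_mul, norm_pow, norm_neg, norm_one, one_pow, one_mul]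
  calc _ ≤ ∑ D ∈ Finset.powersetCard n (Finset.univ : Finset (Fin N)), ‖∏ i ∈ D, ω i‖ := norm_sum_le _ _
    _ ≤ ∑ D ∈ Finset.powersetCard n (Finset.univ : Finset (Fin N)), √q ^ n := by
        refine Finset.sum_le_sum fun D hD => ?_
        rw [Finset.mem_powersetCard] at hD
        rw [norm_prod, ← hD.2]
        exact (Finset.prod_le_prod (fun i _ => norm_nonneg _) (fun i _ => hb i)).trans (by simp)
    _ = _ := by simp

end weilroots

section weil
variable {F : Type*} [Field F] [Fintype F]

/-- character of monic polynomials -/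
noncomputable def psi (m : ℕ) (χ : AddChar (Additive (GG F m)) ℂ) (h : F[X]) : ℂ :=
  χ (Additive.ofMul (cls m h))

lemma psi_one (m : ℕ) (χ : AddChar (Additive (GG F m)) ℂ) : psi m χ 1 = 1 := by
  rw [psi, cls_one, ofMul_one, AddChar.map_zero_eq_one]

lemma psi_mul (m : ℕ) (χ : AddChar (Additive (GG F m)) ℂ) (f g : F[X]) (hf : f.Monic)
    (hg : g.Monic) : psi m χ (f * g) = psi m χ f * psi m χ g := by
  rw [psi, cls_mul m hf hg, ofMul_mul, AddChar.map_add_eq_mul]; rfl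

lemma sum_chi {m : ℕ} {χ : AddChar (Additive (GG F m)) ℂ} (hχ : χ ≠ 0) :
    ∑ g : GG F m, χ (Additive.ofMul g) = 0 := by
  rw [← AddChar.sum_eq_zero_iff_ne_zero] at hχ
  rw [← hχ]
  exact Fintype.sum_equiv Additive.ofMul _ _ (fun _ => rfl)

lemma AA_zero {m : ℕ} {χ : AddChar (Additive (GG F m)) ℂ} (hχ : χ ≠ 0) (n : ℕ) (hn : m ≤ n) :
    AA (psi m χ) n = 0 := by
  classical
  rw [AA, ← Finset.sum_fiberwise (Mon F n) (cls m)]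
  have : ∀ g : GG F m, ∑ h ∈ Mon F n with cls m h = g, psi m χ h =
      (Fintype.card F : ℂ) ^ (n - m) * χ (Additive.ofMul g) := by
    intro g
    rw [Finset.sum_congr rfl (g := fun _ => χ (Additive.ofMul g))
      (fun h hh => by rw [psi, (Finset.mem_filter.1 hh).2]), Finset.sum_const, cls_fiber m n hn g]
    simp
  rw [Finset.sum_congr rfl fun g _ => this g, ← Finset.mul_sum, sum_chi hχ, mul_zero]

lemma SS_bound {m : ℕ} (hm : 1 ≤ m) {χ : AddChar (Additive (GG F m)) ℂ} (hχ : χ ≠ 0) (μ : ℕ)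
    (hμ : Fintype.card F * m ^ 2 + 1 + m ≤ μ) :
    ‖SS (psi m χ) (2 * μ)‖ ≤ ((1 + Fintype.card F * m ^ 2 + m * Fintype.card F) * Fintype.card F ^ m : ℕ)
      * (Fintype.card F : ℝ) ^ μ := by
  classical
  set q := Fintype.card F with hqdef
  have hq : 2 ≤ q := Fintype.one_lt_card
  have hcond : q ^ (μ - m) + q * m ^ 2 < q ^ μ := by
    have h1 : q ^ (μ - m) ≤ q ^ (μ - 1) := Nat.pow_le_pow_right (by omega) (by omega)
    have h2 : 2 * q ^ (μ - 1) ≤ q ^ μ := by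
      obtain ⟨k, rfl⟩ : ∃ k, μ = k + 1 := ⟨μ - 1, by omega⟩
      rw [pow_succ, mul_comm]; simp; gcongr
    have h3 : μ - 1 < q ^ (μ - 1) := Nat.lt_pow_self (by omega)
    omega
  set N : GG F m → ℕ := fun g => ∑ P ∈ IrrDvd F (2 * μ) with
    cls m P ^ (2 * μ / P.natDegree) = g, P.natDegree with hN
  have hfib : ∀ g, N g ≤ q ^ (2 * μ - m) + (1 + q * m ^ 2 + m * q) * q ^ μ := by
    intro g
    obtain ⟨c, hc0, -, hcg⟩ := cl_surj m g
    apply stepanov m μ c (by omega) hcond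
    intro P hP
    rw [Finset.mem_filter, mem_IrrDvd (by omega)] at hP
    obtain ⟨⟨h1, h2, h3⟩, h4⟩ := hP
    refine ⟨h1, h2, h3, ?_⟩
    have e0 : (P.reverse ^ (2 * μ / P.natDegree)).coeff 0 = 1 := by
      have := rev0 h1
      rw [coeff_zero_eq_eval_zero] at this ⊢; simp [this]
    rw [← cl_eq_iff m e0 hc0, cl_pow m (rev0 h1), hcg]
    exact h4
  have hsum : ∑ g, N g = q ^ (2 * μ) := by
    have h1 := SS_one (F := F) (2 * μ) (by omega)
    rw [SS] at h1
    simp only [one_pow, mul_one] at h1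
    have h2 : ∑ P ∈ IrrDvd F (2 * μ), P.natDegree = q ^ (2 * μ) := by exact_mod_cast h1
    rw [← h2, hN]
    exact Finset.sum_fiberwise (IrrDvd F (2 * μ)) (fun P => cls m P ^ (2 * μ / P.natDegree)) _
  have hSS : SS (psi m χ) (2 * μ) = ∑ g, χ (Additive.ofMul g) * (N g : ℂ) := by
    rw [SS, ← Finset.sum_fiberwise (IrrDvd F (2 * μ)) (fun P => cls m P ^ (2 * μ / P.natDegree))]
    refine Finset.sum_congr rfl fun g _ => ?_
    rw [hN]
    push_cast
    rw [Finset.mul_sum]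
    refine Finset.sum_congr rfl fun P hP => ?_
    rw [← (Finset.mem_filter.1 hP).2, psi, ofMul_pow, AddChar.map_nsmul_eq_pow, mul_comm]
  set B : ℕ := q ^ (2 * μ - m) + (1 + q * m ^ 2 + m * q) * q ^ μ with hB
  have hSS' : SS (psi m χ) (2 * μ) = -∑ g, χ (Additive.ofMul g) * ((B : ℂ) - N g) := by
    rw [hSS]
    simp only [mul_sub, Finset.sum_sub_distrib, ← Finset.sum_mul, sum_chi hχ, zero_mul]
    ring
  rw [hSS', norm_neg]
  calc _ ≤ ∑ g, ‖χ (Additive.ofMul g) * ((B : ℂ) - N g)‖ := norm_sum_le _ _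
    _ = ∑ g, ((B : ℝ) - N g) := by
      refine Finset.sum_congr rfl fun g _ => ?_
      rw [norm_mul, AddChar.norm_apply, one_mul, ← Nat.cast_sub (hfib g), Complex.norm_natCast,
        Nat.cast_sub (hfib g)]
    _ = (q : ℝ) ^ m * B - (q : ℝ) ^ (2 * μ) := by
      have hs : ∑ g, (N g : ℝ) = (q : ℝ) ^ (2 * μ) := by exact_mod_cast hsum
      rw [Finset.sum_sub_distrib, hs]
      simp [card_GG, hqdef]
    _ ≤ _ := by
      have : (q : ℝ) ^ (2 * μ) = q ^ m * q ^ (2 * μ - m) := by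
        rw [← pow_add]; congr 1; omega
      rw [this, hB]
      push_cast
      apply le_of_eq
      ring

lemma weil_AA {m : ℕ} (hm : 1 ≤ m) {χ : AddChar (Additive (GG F m)) ℂ} (hχ : χ ≠ 0) (n : ℕ) :
    ‖AA (psi m χ) n‖ ≤ ((m - 1).choose n : ℝ) * √(Fintype.card F : ℝ) ^ n := by
  refine weil_roots (AA (psi m χ)) (SS (psi m χ)) (m - 1) ?_ ?_ ?_ (Fintype.card F : ℝ) _
    (by exact_mod_cast Fintype.card_pos) _ (fun μ hμ => SS_bound hm hχ μ hμ) n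
  · rw [AA, Mon_zero, Finset.sum_singleton, psi_one]
  · intro n hn; exact AA_zero hχ n (by omega)
  · exact conv_identity _ (psi_one m χ) (psi_mul m χ)

lemma AA_one (m : ℕ) (χ : AddChar (Additive (GG F m)) ℂ) :
    AA (psi m χ) 1 = ∑ a : F, psi m χ (X - C a) := by
  rw [AA]
  symm
  refine Finset.sum_bij (fun a _ => X - C a) ?_ ?_ ?_ ?_
  · intro a _; rw [mem_Mon]; exact ⟨monic_X_sub_C a, natDegree_X_sub_C a⟩
  · intro a _ b _ h; simpa using h
  · intro h hh
    rw [mem_Mon] at hh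
    refine ⟨-h.coeff 0, Finset.mem_univ _, ?_⟩
    rw [hh.1.eq_X_add_C hh.2]; simp
  · intro a _; rfl

lemma char_ne {m : ℕ} {χ : AddChar (Additive (GG F m)) ℂ} (hχ : χ ≠ 0) (p : ℕ) [hp : Fact p.Prime]
    [CharP F p] (j : ℕ) (hj : ¬ p ∣ j) : j • χ ≠ 0 := by
  obtain ⟨n, -, hn⟩ := FiniteField.card F p
  intro h
  have h1 : addOrderOf χ ∣ j := addOrderOf_dvd_of_nsmul_eq_zero h
  have h2 : (p ^ ((n : ℕ) * m)) • χ = 0 := by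
    ext g
    rw [AddChar.nsmul_apply, ← AddChar.map_nsmul_eq_pow, pow_mul, ← hn, ← card_GG m]
    rw [show Fintype.card (GG F m) • g = 0 from by
      have h5 := card_nsmul_eq_zero (x := g)
      have h6 : Fintype.card (GG F m) = Fintype.card (Additive (GG F m)) :=
        Fintype.card_congr Additive.ofMul
      rw [h6]; exact h5]
    simp
  have h3 : addOrderOf χ ∣ p ^ ((n : ℕ) * m) := addOrderOf_dvd_of_nsmul_eq_zero h2
  have hcop : Nat.Coprime j (p ^ ((n : ℕ) * m)) :=
    (((Nat.Prime.coprime_iff_not_dvd hp.out).2 hj).symm).pow_right _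
  have := Nat.dvd_gcd h1 h3
  rw [hcop.gcd_eq_one, Nat.dvd_one, AddMonoid.addOrderOf_eq_one_iff] at this
  exact hχ this

lemma E_bound [DecidableEq F] {m : ℕ} (hm : 1 ≤ m) {χ : AddChar (Additive (GG F m)) ℂ} (hχ : χ ≠ 0) (p : ℕ)
    [hp : Fact p.Prime] [CharP F p] (r : ℕ) :
    ‖∑ D ∈ Finset.powersetCard r (Finset.univ : Finset F), ∏ a ∈ D, psi m χ (X - C a)‖ ≤
      gchoose ((Fintype.card F : ℝ) / p + m * √(Fintype.card F : ℝ) + r) r := by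
  rw [gchoose_eq (by positivity)]
  refine esymm_bound _ (m * √(Fintype.card F : ℝ)) (Fintype.card F : ℝ) _ p hp.out.pos (by positivity)
    (by linarith) (by
      have : 0 ≤ (Fintype.card F : ℝ) / p + m * √(Fintype.card F : ℝ) := by positivity
      linarith) ?_ r
  intro j hj
  by_cases hpj : p ∣ j
  · rw [if_pos hpj]
    have : ‖∑ a : F, psi m χ (X - C a) ^ j‖ ≤ Fintype.card F := by
      refine (norm_sum_le _ _).trans ?_
      simp [psi, AddChar.norm_apply]
    have h2 : 0 ≤ m * √(Fintype.card F : ℝ) := by positivity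
    linarith
  · rw [if_neg hpj, add_zero]
    have h1 : ∑ a : F, psi m χ (X - C a) ^ j = AA (psi m (j • χ)) 1 := by
      rw [AA_one]; simp [psi, AddChar.nsmul_apply]
    rw [h1]
    refine (weil_AA hm (char_ne hχ p j hpj) 1).trans ?_
    rw [Nat.choose_one_right, pow_one]
    gcongr
    omega

end weil

section final
variable {F : Type*} [Field F] [Fintype F]

lemma monic_prodD (D : Finset F) : (∏ a ∈ D, (X - C a)).Monic :=
  monic_prod_of_monic _ _ fun a _ => monic_X_sub_C a

lemma natDegree_prodD (D : Finset F) : (∏ a ∈ D, (X - C a)).natDegree = D.card := by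
  rw [natDegree_prod_of_monic _ _ fun a _ => monic_X_sub_C a]; simp

lemma psi_prodD (m : ℕ) (χ : AddChar (Additive (GG F m)) ℂ) (D : Finset F) :
    psi m χ (∏ a ∈ D, (X - C a)) = ∏ a ∈ D, psi m χ (X - C a) := by
  classical
  induction D using Finset.induction_on with
  | empty => simp [psi_one]
  | insert a D ha ih =>
    rw [Finset.prod_insert ha, Finset.prod_insert ha, psi_mul _ _ _ _ (monic_X_sub_C a) (monic_prodD D), ih]

open Classical in
/-- the counted pairs, reformulated -/
noncomputable def Pairs (m r n : ℕ) (f : F[X]) : Finset (Finset F × F[X]) :=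
  (Finset.powersetCard r (Finset.univ : Finset F) ×ˢ Mon F n).filter
    fun x => cls m ((∏ a ∈ x.1, (X - C a)) * x.2) = cls m f

lemma card_pairs (k m r : ℕ) (hr2 : r ≤ k + m) (f : F[X]) (hf : f.Monic) (hdeg : f.natDegree = k + m) :
    Nat.card {Dg : Finset F × Polynomial F // Dg.1.card = r ∧
          Dg.2.degree < (k : ℕ) ∧ ∀ a ∈ Dg.1, (f + Dg.2).eval a = 0} =
      (Pairs m r (k + m - r) f).card := by
  classical
  rw [← Fintype.card_coe, ← Nat.card_eq_fintype_card]
  symm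
  have key : ∀ x : Finset F × F[X], x ∈ Pairs m r (k + m - r) f ↔
      x.1.card = r ∧ x.2.Monic ∧ x.2.natDegree = k + m - r ∧
      ((∏ a ∈ x.1, (X - C a)) * x.2 - f).degree < (k : ℕ) := by
    intro x
    simp only [Pairs, Finset.mem_filter, Finset.mem_product, Finset.mem_powersetCard, mem_Mon,
      Finset.subset_univ, true_and]
    constructor
    · rintro ⟨⟨h1, h2, h3⟩, h4⟩
      refine ⟨h1, h2, h3, ?_⟩
      rw [cls_eq_iff m (k + m) (by omega) hf ((monic_prodD _).mul h2) hdeg (by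
        rw [(monic_prodD _).natDegree_mul h2, natDegree_prodD]; omega)] at h4
      simpa using h4
    · rintro ⟨h1, h2, h3, h4⟩
      refine ⟨⟨h1, h2, h3⟩, ?_⟩
      rw [cls_eq_iff m (k + m) (by omega) hf ((monic_prodD _).mul h2) hdeg (by
        rw [(monic_prodD _).natDegree_mul h2, natDegree_prodD]; omega)]
      simpa using h4
  refine Nat.card_eq_of_bijective (fun x : Pairs m r (k + m - r) f =>
    ⟨(x.1.1, (∏ a ∈ x.1.1, (X - C a)) * x.1.2 - f), ?_⟩) ⟨?_, ?_⟩
  · obtain ⟨h1, h2, h3, h4⟩ := (key x.1).1 x.2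
    refine ⟨h1, h4, fun a ha => ?_⟩
    simp only [add_sub_cancel, eval_mul, eval_prod]
    rw [Finset.prod_eq_zero ha (by simp), zero_mul]
  · rintro ⟨⟨D, h⟩, hx⟩ ⟨⟨D', h'⟩, hx'⟩ he
    simp only [Subtype.mk.injEq, Prod.mk.injEq, sub_left_inj] at he
    obtain ⟨rfl, he⟩ := he
    have := mul_left_cancel₀ (monic_prodD D).ne_zero he
    subst this; rfl
  · rintro ⟨⟨D, g⟩, h1, h2, h3⟩
    simp only at h1 h2 h3
    have hlt : g.degree < f.degree := by
      rw [degree_eq_natDegree hf.ne_zero, hdeg]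
      exact h2.trans_le (by exact_mod_cast Nat.le_add_right k m)
    have hmon : (f + g).Monic := hf.add_of_left hlt
    have hnd : (f + g).natDegree = k + m := by
      rw [natDegree_add_eq_left_of_degree_lt hlt, hdeg]
    have hdvd : (∏ a ∈ D, (X - C a)) ∣ f + g := by
      apply Finset.prod_dvd_of_coprime
      · intro a _ b _ hab
        exact pairwise_coprime_X_sub_C (Function.injective_id) hab
      · intro a ha
        rw [dvd_iff_isRoot]; exact h3 a ha
    obtain ⟨h, hh⟩ := hdvd
    have hhm : h.Monic := (monic_prodD D).of_mul_monic_left (hh ▸ hmon)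
    have hhd : h.natDegree = k + m - r := by
      rw [hh, (monic_prodD _).natDegree_mul hhm, natDegree_prodD] at hnd; omega
    refine ⟨⟨(D, h), (key _).2 ⟨h1, hhm, hhd, ?_⟩⟩, ?_⟩
    · simp only [← hh]; simpa using h2
    · simp only [← hh]; simp

lemma pairs_sum (m r n : ℕ) (f : F[X]) :
    ((Pairs m r n f).card : ℂ) * (Fintype.card F : ℂ) ^ m =
      ∑ χ : AddChar (Additive (GG F m)) ℂ, χ (-(Additive.ofMul (cls m f))) *
        ((∑ D ∈ Finset.powersetCard r (Finset.univ : Finset F), ∏ a ∈ D, psi m χ (X - C a)) *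
          AA (psi m χ) n) := by
  classical
  have h1 : ∀ χ : AddChar (Additive (GG F m)) ℂ, χ (-(Additive.ofMul (cls m f))) *
        ((∑ D ∈ Finset.powersetCard r (Finset.univ : Finset F), ∏ a ∈ D, psi m χ (X - C a)) *
          AA (psi m χ) n) = ∑ x ∈ Finset.powersetCard r (Finset.univ : Finset F) ×ˢ Mon F n,
        χ (Additive.ofMul (cls m ((∏ a ∈ x.1, (X - C a)) * x.2)) - Additive.ofMul (cls m f)) := by
    intro χ
    rw [AA, Finset.sum_mul_sum, ← Finset.sum_product', Finset.mul_sum]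
    refine Finset.sum_congr rfl fun x hx => ?_
    have hx2 := (mem_Mon.1 (Finset.mem_product.1 hx).2).1
    rw [sub_eq_neg_add, AddChar.map_add_eq_mul, ← psi_prodD, ← psi_mul _ _ _ _ (monic_prodD _) hx2]
    rfl
  rw [Finset.sum_congr rfl fun χ _ => h1 χ, Finset.sum_comm]
  simp only [AddChar.sum_apply_eq_ite, sub_eq_zero]
  rw [← Finset.sum_filter, Finset.sum_const, nsmul_eq_mul]
  have h6 : Fintype.card (Additive (GG F m)) = Fintype.card F ^ m := by
    rw [← card_GG m]; exact Fintype.card_congr Additive.ofMul.symm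
  rw [h6]
  push_cast
  congr 3

end final

/-- For `f` monic of degree `d = k+m ≤ q-1` and `k+1 ≤ r ≤ d`, the number
`M(f,r)` of pairs `(D_r, g)` with `D_r` an `r`-subset of `F_q`, `deg g ≤ k-1`, and
`f + g` vanishing on `D_r` satisfies
`|M(f,r) - C(q,r) q^(k-r)| ≤ C(q/p + m√q + r, r) C(m-1, d-r) q^((d-r)/2)`. -/
theorem stmt_12 {F : Type*} [Field F] [Fintype F] [DecidableEq F]
    (q p : ℕ) (hcard : Fintype.card F = q) [hp : Fact p.Prime] [CharP F p]
    (k m r : ℕ) (hk : 1 ≤ k) (hkm : k + m ≤ q - 1)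
    (hr1 : k + 1 ≤ r) (hr2 : r ≤ k + m)
    (f : Polynomial F) (hf : f.Monic) (hdeg : f.natDegree = k + m) :
    |(Nat.card {Dg : Finset F × Polynomial F // Dg.1.card = r ∧
          Dg.2.degree < (k : ℕ) ∧ ∀ a ∈ Dg.1, (f + Dg.2).eval a = 0} : ℝ)
        - (q.choose r : ℝ) * (q : ℝ) ^ ((k : ℤ) - (r : ℤ))|
      ≤ gchoose ((q : ℝ) / (p : ℝ) + (m : ℝ) * Real.sqrt q + (r : ℝ)) (r : ℝ) *
          ((m - 1).choose (k + m - r) : ℝ) * Real.sqrt q ^ (k + m - r) := by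
  classical
  rw [card_pairs k m r hr2 f hf hdeg]
  subst hcard
  set q := Fintype.card F with hq
  have hq0 : 0 < q := Fintype.card_pos
  have hqR : (0 : ℝ) < q := by exact_mod_cast hq0
  set n := k + m - r with hn
  set B : ℝ := gchoose ((q : ℝ) / (p : ℝ) + (m : ℝ) * Real.sqrt q + (r : ℝ)) (r : ℝ) *
          ((m - 1).choose n : ℝ) * Real.sqrt q ^ n with hB
  have hg0 : 0 ≤ gchoose ((q : ℝ) / (p : ℝ) + (m : ℝ) * Real.sqrt q + (r : ℝ)) (r : ℝ) := by
    rw [gchoose_eq (by positivity)]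
    refine (risc_pos ?_ r).le
    have : 0 ≤ (q : ℝ) / (p : ℝ) + (m : ℝ) * Real.sqrt q := by positivity
    linarith
  have hB0 : 0 ≤ B := by positivity
  have hS := pairs_sum m r n f
  rw [← Finset.add_sum_erase _ _ (Finset.mem_univ (0 : AddChar (Additive (GG F m)) ℂ))] at hS
  have h0 : (0 : AddChar (Additive (GG F m)) ℂ) (-(Additive.ofMul (cls m f))) *
        ((∑ D ∈ Finset.powersetCard r (Finset.univ : Finset F), ∏ a ∈ D, psi (F := F) m 0 (X - C a)) *
          AA (psi (F := F) m 0) n) = (q.choose r : ℂ) * (q : ℂ) ^ n := by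
    simp [psi, AA, card_Mon, hq]
  rw [h0] at hS
  set R : ℂ := ∑ χ ∈ Finset.univ.erase (0 : AddChar (Additive (GG F m)) ℂ),
    χ (-(Additive.ofMul (cls m f))) *
        ((∑ D ∈ Finset.powersetCard r (Finset.univ : Finset F), ∏ a ∈ D, psi m χ (X - C a)) *
          AA (psi m χ) n) with hR
  have hRb : ‖R‖ ≤ (q : ℝ) ^ m * B := by
    have h6 : Fintype.card (Additive (GG F m)) = Fintype.card F ^ m := by
      rw [← card_GG m]; exact Fintype.card_congr Additive.ofMul.symm
    calc ‖R‖ ≤ ∑ χ ∈ Finset.univ.erase (0 : AddChar (Additive (GG F m)) ℂ), B := by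
          refine norm_sum_le_of_le _ fun χ hχ => ?_
          have hχ := (Finset.mem_erase.1 hχ).1
          rw [norm_mul, AddChar.norm_apply, one_mul, norm_mul, hB, mul_assoc]
          exact mul_le_mul (E_bound (by omega) hχ p r) (weil_AA (by omega) hχ n) (norm_nonneg _) hg0
      _ ≤ ∑ χ : AddChar (Additive (GG F m)) ℂ, B :=
          Finset.sum_le_sum_of_subset_of_nonneg (Finset.erase_subset _ _) fun _ _ _ => hB0
      _ = (q : ℝ) ^ m * B := by
          rw [Finset.sum_const, Finset.card_univ, AddChar.card_eq, h6, nsmul_eq_mul]; push_cast; rfl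
  have hz : (q : ℝ) ^ ((k : ℤ) - (r : ℤ)) * (q : ℝ) ^ m = (q : ℝ) ^ n := by
    rw [← zpow_natCast, ← zpow_natCast, ← zpow_add₀ hqR.ne']
    congr 1
    omega
  have hfin : ((((Pairs m r n f).card : ℝ) - (q.choose r : ℝ) * (q : ℝ) ^ ((k : ℤ) - (r : ℤ))) *
      (q : ℝ) ^ m : ℝ) = ((Pairs m r n f).card : ℝ) * (q : ℝ) ^ m - (q.choose r : ℝ) * (q : ℝ) ^ n := by
    rw [sub_mul, mul_assoc, hz]
  have hnorm : |((Pairs m r n f).card : ℝ) - (q.choose r : ℝ) * (q : ℝ) ^ ((k : ℤ) - (r : ℤ))| *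
      (q : ℝ) ^ m = ‖R‖ := by
    have hRe : R = (((((Pairs m r n f).card : ℝ) * (q : ℝ) ^ m - (q.choose r : ℝ) * (q : ℝ) ^ n : ℝ)) : ℂ) := by
      push_cast
      rw [hS]; ring
    rw [hRe, Complex.norm_real, ← hfin, norm_mul, Real.norm_eq_abs, Real.norm_eq_abs,
      abs_of_pos (pow_pos hqR m)]
  have hpos : (0 : ℝ) < (q : ℝ) ^ m := pow_pos hqR m
  refine le_of_mul_le_mul_right ?_ hpos
  rw [hnorm, mul_comm B]
  exact hRb
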